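/- There exists a finite 4-regular planar straight-line unit-distance graph in the Euclidean plane consisting only of unit triangles without additional triangles, having exactly 6422 = 169·38 unit triangles, which is invariant under the rotation about some center point by the angle 2π/169; i.e., the rotation by 2π/169 about that center maps the vertex set onto itself and the edge set onto itself (a rigid ring graph with rotational symmetry of order 169). -/

import Mathlib

/-!
Straight-line unit-distance graphs in the Euclidean plane, modelled as ℂ.
-/

noncomputable section
open scoped Classical

/-- A finite straight-line unit-distance graph in the plane: a finite vertex
set `V ⊆ ℂ` and a finite set `E` of 2-element subsets of `V` (edges), each of
whose two endpoints are at distance one. -/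
structure UnitDistGraph where
  V : Finset ℂ
  E : Finset (Finset ℂ)
  edge_sub : ∀ e ∈ E, e ⊆ V
  edge_pair : ∀ e ∈ E, ∃ x y : ℂ, x ≠ y ∧ e = {x, y} ∧ dist x y = 1

namespace UnitDistGraph

/-- The closed segment drawn for an edge (the convex hull of its two endpoints). -/
def edgeSeg (e : Finset ℂ) : Set ℂ := convexHull ℝ (e : Set ℂ)

/-- The degree of a vertex: the number of edges containing it. -/
def degree (G : UnitDistGraph) (v : ℂ) : ℕ := {e | e ∈ G.E ∧ v ∈ e}.ncard

/-- The graph is drawn planarly: two distinct closed edge segments intersect in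
at most a common endpoint, and no vertex lies in the relative interior of an
edge (i.e. a vertex on a closed edge segment is an endpoint of that edge). -/
def Planar (G : UnitDistGraph) : Prop :=
  (∀ e ∈ G.E, ∀ f ∈ G.E, e ≠ f →
    edgeSeg e ∩ edgeSeg f ⊆ (e : Set ℂ) ∩ (f : Set ℂ)) ∧
  (∀ v ∈ G.V, ∀ e ∈ G.E, v ∈ edgeSeg e → v ∈ e)

/-- The graph is 4-regular: every vertex belongs to exactly 4 edges. -/
def Regular4 (G : UnitDistGraph) : Prop := ∀ v ∈ G.V, G.degree v = 4

/-- A unit triangle: a 3-element subset of `V` all of whose pairs are edges. -/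
def IsUnitTriangle (G : UnitDistGraph) (t : Finset ℂ) : Prop :=
  t ⊆ G.V ∧ t.card = 3 ∧ ∀ x ∈ t, ∀ y ∈ t, x ≠ y → ({x, y} : Finset ℂ) ∈ G.E

/-- The number of unit triangles of the graph. -/
def triangleCount (G : UnitDistGraph) : ℕ := {t : Finset ℂ | G.IsUnitTriangle t}.ncard

/-- The graph consists only of unit triangles: every edge lies in a unit triangle. -/
def OnlyUnitTriangles (G : UnitDistGraph) : Prop :=
  ∀ e ∈ G.E, ∃ t : Finset ℂ, G.IsUnitTriangle t ∧ e ⊆ t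

/-- The closed segment from `x` to `y` is a union of closed edge segments of `E`. -/
def SideCovered (G : UnitDistGraph) (x y : ℂ) : Prop :=
  ∃ S : Finset (Finset ℂ), S ⊆ G.E ∧ segment ℝ x y = ⋃ e ∈ S, edgeSeg e

/-- No additional triangles: any equilateral triangle on vertices of `V` each of
whose sides is a union of closed edge segments has side length 1. -/
def NoAdditionalTriangles (G : UnitDistGraph) : Prop :=
  ∀ x ∈ G.V, ∀ y ∈ G.V, ∀ z ∈ G.V, x ≠ y → y ≠ z → x ≠ z →
    dist x y = dist y z → dist y z = dist z x →
    G.SideCovered x y → G.SideCovered y z → G.SideCovered z x →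
    dist x y = 1

end UnitDistGraph

open UnitDistGraph

namespace UnitDistGraph

/-- Rotation of the plane about the center `c` by the angle `θ`. -/
def rot (c : ℂ) (θ : ℝ) (z : ℂ) : ℂ := c + Complex.exp (θ * Complex.I) * (z - c)

/-- The graph is invariant under the rotation about `c` by `θ`: this rotation
maps the vertex set onto itself and the edge set onto itself. -/
def RotInvariant (G : UnitDistGraph) (c : ℂ) (θ : ℝ) : Prop :=
  (rot c θ) '' (G.V : Set ℂ) = (G.V : Set ℂ) ∧
  (Finset.image (rot c θ)) '' (G.E : Set (Finset ℂ)) = (G.E : Set (Finset ℂ))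

/-- The unit triangles of the graph are non-overlapping: the interiors of the
closed triangular regions of two distinct unit triangles are disjoint. -/
def NonOverlapping (G : UnitDistGraph) : Prop :=
  ∀ t₁ t₂ : Finset ℂ, G.IsUnitTriangle t₁ → G.IsUnitTriangle t₂ → t₁ ≠ t₂ →
    interior (convexHull ℝ (t₁ : Set ℂ)) ∩ interior (convexHull ℝ (t₂ : Set ℂ)) = ∅

/-- The line through the point `c` with direction `d`. -/
def line (c d : ℂ) : Set ℂ := {z : ℂ | ∃ t : ℝ, z = c + (t : ℂ) * d}

/-- Two unit-distance graphs are congruent if some isometry of the plane maps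
the vertex set and edge set of one onto those of the other. -/
def Congruent (G₁ G₂ : UnitDistGraph) : Prop :=
  ∃ φ : ℂ ≃ᵢ ℂ, G₁.V.image φ = G₂.V ∧ G₁.E.image (Finset.image φ) = G₂.E

end UnitDistGraph

namespace HalfSector

/-- The 19 unit triangles of the half sector on the vertices `0, …, 36`. The vertices `0, …, 7`
lie on the real axis, the vertices `8, …, 16` on the other mirror line, and all others strictly
between the two mirror lines. -/
def triangles : List (Fin 37 × Fin 37 × Fin 37) :=
  [
    (0, 17, 18), (1, 18, 19), (2, 19, 20), (3, 20, 21), (4, 21, 22), (5, 22, 23), (6, 23, 24),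
    (8, 17, 25), (9, 25, 26), (10, 26, 27), (11, 27, 28), (12, 28, 29), (13, 29, 30), (14, 30,
    31), (32, 24, 31), (32, 33, 34), (15, 33, 35), (16, 35, 36), (34, 36, 7)]

/-- The 57 edges of the half sector. -/
def edges : List (Fin 37 × Fin 37) :=
  [
    (0, 17), (17, 18), (0, 18), (1, 18), (18, 19), (1, 19), (2, 19), (19, 20), (2, 20), (3, 20),
    (20, 21), (3, 21), (4, 21), (21, 22), (4, 22), (5, 22), (22, 23), (5, 23), (6, 23), (23,
    24), (6, 24), (8, 17), (17, 25), (8, 25), (9, 25), (25, 26), (9, 26), (10, 26), (26, 27),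
    (10, 27), (11, 27), (27, 28), (11, 28), (12, 28), (28, 29), (12, 29), (13, 29), (29, 30),
    (13, 30), (14, 30), (30, 31), (14, 31), (24, 32), (24, 31), (31, 32), (32, 33), (33, 34),
    (32, 34), (15, 33), (33, 35), (15, 35), (16, 35), (35, 36), (16, 36), (34, 36), (7, 36), (7,
    34)]

/-- The lists of neighbours of the vertices of the half sector. -/
def nbrTable : List (List (Fin 37)) :=
  [
    [17, 18], [18, 19], [19, 20], [20, 21], [21, 22], [22, 23], [23, 24], [34, 36], [17, 25],
    [25, 26], [26, 27], [27, 28], [28, 29], [29, 30], [30, 31], [33, 35], [35, 36], [0, 8, 18,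
    25], [0, 1, 17, 19], [1, 2, 18, 20], [2, 3, 19, 21], [3, 4, 20, 22], [4, 5, 21, 23], [5, 6,
    22, 24], [6, 23, 31, 32], [8, 9, 17, 26], [9, 10, 25, 27], [10, 11, 26, 28], [11, 12, 27,
    29], [12, 13, 28, 30], [13, 14, 29, 31], [14, 24, 30, 32], [24, 31, 33, 34], [15, 32, 34,
    35], [7, 32, 33, 36], [15, 16, 33, 36], [7, 16, 34, 35]]

/-- The neighbours of a vertex of the half sector. -/
def nbrs (i : Fin 37) : List (Fin 37) := nbrTable.getD i []

/-- Real parts of the vertices, in units of `10⁻¹⁰`. -/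
def xs : List ℤ :=
  [
    1041705939654, 1024385747856, 1024385115319, 1007064923520, 1007064290984, 989744099185,
    989743466648, 952238088481, 1038026660067, 1025313958907, 1018302932587, 1005590231427,
    998579205108, 985866503948, 978855477629, 971890139917, 951909068814, 1041706255923,
    1033045843755, 1024385431587, 1015725019420, 1007064607252, 998404195084, 989743782917,
    981083370749, 1031813791930, 1021982528443, 1012090064451, 1002258800964, 992366336971,
    982535073485, 972642609492, 972219159584, 967399948210, 962221312909, 961906915489,
    956728280188]

/-- Imaginary parts of the vertices, in units of `10⁻¹⁰`. -/
def ys : List ℤ :=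
  [
    0, 0, 0, 0, 0, 0, 0, 0, 19298417835, 19062070323, 18931725198, 18695377685, 18565032560,
    18328685047, 18198339922, 18068844214, 17697367185, 9999999995, 5000273894, 9999999995,
    5000273894, 9999999995, 5000273894, 9999999995, 5000273894, 11462585428, 9633307357,
    11095892790, 9266614719, 10729200152, 8899922081, 10362507514, 371477028, 9133622983,
    578990530, 17489853684, 8935221231]

/-- Approximate real part of a vertex, in units of `10⁻¹⁰`. -/
def X (i : Fin 37) : ℤ := xs.getD i 0

/-- Approximate imaginary part of a vertex, in units of `10⁻¹⁰`. -/
def Y (i : Fin 37) : ℤ := ys.getD i 0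

/-- The approximate projection of a vertex to the axis `(a, b)`. -/
def proj (a b : ℤ) (i : Fin 37) : ℤ := a * X i + b * Y i

/-- The axis `(a, b)` separates the edge `e` from the edge `f` with room for rounding errors. -/
def SepBelow (a b : ℤ) (e f : Fin 37 × Fin 37) : Prop :=
  proj a b e.1 + 200 * (a.natAbs + b.natAbs) < proj a b f.1 ∧
  proj a b e.1 + 200 * (a.natAbs + b.natAbs) < proj a b f.2 ∧
  proj a b e.2 + 200 * (a.natAbs + b.natAbs) < proj a b f.1 ∧
  proj a b e.2 + 200 * (a.natAbs + b.natAbs) < proj a b f.2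

instance (a b : ℤ) (e f : Fin 37 × Fin 37) : Decidable (SepBelow a b e f) := by
  unfold SepBelow; infer_instance

/-- A normal of one of the two edges separates them. -/
def Sep (e f : Fin 37 × Fin 37) : Prop :=
  SepBelow (Y e.1 - Y e.2) (X e.2 - X e.1) e f ∨ SepBelow (Y e.1 - Y e.2) (X e.2 - X e.1) f e ∨
  SepBelow (Y f.1 - Y f.2) (X f.2 - X f.1) e f ∨ SepBelow (Y f.1 - Y f.2) (X f.2 - X f.1) f e

instance (e f : Fin 37 × Fin 37) : Decidable (Sep e f) := by
  unfold Sep; infer_instance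

/-- The directions from `i` to `j` and from `i` to `k` are linearly independent, with room for
rounding errors. -/
def Transverse (i j k : Fin 37) : Prop :=
  10 ^ 14 < ((X j - X i) * (Y k - Y i) - (X k - X i) * (Y j - Y i)).natAbs

instance (i j k : Fin 37) : Decidable (Transverse i j k) := by
  unfold Transverse; infer_instance

theorem edges_separated : edges.Pairwise fun e f =>
    SepBelow 1 0 e f ∨ SepBelow 1 0 f e ∨
    (e.1 = f.1 ∧ Transverse e.1 e.2 f.2) ∨ (e.1 = f.2 ∧ Transverse e.1 e.2 f.1) ∨
    (e.2 = f.1 ∧ Transverse e.2 e.1 f.2) ∨ (e.2 = f.2 ∧ Transverse e.2 e.1 f.1) ∨ Sep e f := by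
  decide +kernel

theorem vertices_separated : ∀ i j : Fin 37, i < j →
    200 < (X i - X j).natAbs ∨ 200 < (Y i - Y j).natAbs := by
  decide +kernel

theorem mem_edges_of_mem_nbrs : ∀ i, ∀ j ∈ nbrs i, j < i ∨ (i, j) ∈ edges := by
  decide +kernel

theorem mem_nbrs_symm : ∀ i, ∀ j ∈ nbrs i, i ∈ nbrs j := by
  decide +kernel

theorem nbrs_irrefl : ∀ i, i ∉ nbrs i := by
  decide +kernel

theorem nbrs_nodup : ∀ i, (nbrs i).Nodup := by
  decide +kernel

theorem length_nbrs : ∀ i, (nbrs i).length = if i < 17 then 2 else 4 := by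
  decide +kernel

theorem transverse_of_mem_nbrs : ∀ i, ∀ j ∈ nbrs i, ∀ k ∈ nbrs i, j = k ∨ Transverse i j k := by
  decide +kernel

theorem lower_mirror_not_straight : ∀ i, ∀ j ∈ nbrs i, ∀ k ∈ nbrs i, 8 ≤ i ∨
    400 < (X j + X k - 2 * X i).natAbs ∨ 200 < (Y j - Y k).natAbs := by
  decide +kernel

theorem upper_mirror_not_straight : ∀ i, ∀ j ∈ nbrs i, ∀ k ∈ nbrs i, i < 8 ∨ 17 ≤ i ∨
    2 * 10 ^ 9 < (X j + X k - 2 * X i).natAbs ∨ 2 * 10 ^ 9 < (Y j - Y k).natAbs := by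
  decide +kernel

theorem inner_or_inner_of_mem_nbrs : ∀ i, ∀ j ∈ nbrs i, 17 ≤ i ∨ 17 ≤ j := by
  decide +kernel

theorem exists_triangle_of_mem_nbrs : ∀ i, ∀ j ∈ nbrs i, ∃ k, k ∈ nbrs i ∧ k ∈ nbrs j := by
  decide +kernel

theorem Y_pos : ∀ i : Fin 37, 8 ≤ i → 1000 < Y i := by
  decide +kernel

theorem X_bounds : ∀ i : Fin 37, 95 * 10 ^ 10 < X i ∧ X i < 105 * 10 ^ 10 ∧ Y i < 2 * 10 ^ 10 := by
  decide +kernel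

/-- The vertex sets of the 19 unit triangles of the half sector. -/
def cliques : Finset (Finset (Fin 37)) :=
  (triangles.map fun t => {t.1, t.2.1, t.2.2}).toFinset

theorem card_cliques : cliques.card = 19 := by
  rw [cliques, List.toFinset_card_of_nodup]
  · rfl
  · have h : triangles.Pairwise fun s t =>
        ¬ ((s.1 = t.1 ∨ s.1 = t.2.1 ∨ s.1 = t.2.2) ∧ (s.2.1 = t.1 ∨ s.2.1 = t.2.1 ∨ s.2.1 = t.2.2) ∧
          (s.2.2 = t.1 ∨ s.2.2 = t.2.1 ∨ s.2.2 = t.2.2)) := by decide +kernel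
    refine List.pairwise_map.2 (h.imp ?_)
    rintro ⟨i, j, k⟩ ⟨l, m, n⟩ h heq
    simp only [Finset.ext_iff, Finset.mem_insert, Finset.mem_singleton] at heq
    exact h ⟨(heq i).1 (.inl rfl), (heq j).1 (.inr (.inl rfl)), (heq k).1 (.inr (.inr rfl))⟩

theorem any_triangles : ∀ i, ∀ j ∈ nbrs i, ∀ k ∈ nbrs i, k ∉ nbrs j ∨
    ([(i, j, k), (i, k, j), (j, i, k), (j, k, i), (k, i, j), (k, j, i)].any
      fun t => triangles.elem t) = true := by
  decide +kernel

theorem mem_cliques {i j k : Fin 37} (hj : j ∈ nbrs i) (hk : k ∈ nbrs i) (hjk : k ∈ nbrs j) :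
    {i, j, k} ∈ cliques := by
  have h := (any_triangles i j hj k hk).resolve_left (not_not.2 hjk)
  simp only [List.any_eq_true, List.elem_eq_mem, decide_eq_true_eq] at h
  obtain ⟨t, ht, h⟩ := h
  simp only [cliques, List.mem_toFinset, List.mem_map]
  refine ⟨t, h, ?_⟩
  simp only [List.mem_cons, List.not_mem_nil, or_false] at ht
  rcases ht with rfl | rfl | rfl | rfl | rfl | rfl
  all_goals
    ext
    simp only [Finset.mem_insert, Finset.mem_singleton]
    try tauto

theorem inner_of_mem_triangles : ∀ t ∈ triangles, 17 ≤ t.2.1 := by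
  simp [triangles]

theorem mem_nbrs_of_mem_triangles : ∀ t ∈ triangles,
    t.2.1 ∈ nbrs t.1 ∧ t.2.2 ∈ nbrs t.1 ∧ t.2.2 ∈ nbrs t.2.1 := by
  simp [triangles, nbrs, nbrTable]

/-- The angle between the two mirror lines. -/
def mirrorAngle : ℝ := Real.pi / 169

/-- A realization of the half sector in the plane between the two mirror lines. -/
structure IsRealization (P : Fin 37 → ℂ) : Prop where
  re_near : ∀ i, |(P i).re * 10 ^ 10 - X i| ≤ 100
  im_near : ∀ i, |(P i).im * 10 ^ 10 - Y i| ≤ 100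
  dist_eq_one : ∀ e ∈ edges, dist (P e.1) (P e.2) = 1
  im_eq_zero : ∀ i, i < 8 → (P i).im = 0
  mem_upper : ∀ i, 8 ≤ i → i < 17 →
    (P i).im * Real.cos mirrorAngle = (P i).re * Real.sin mirrorAngle

namespace IsRealization

variable {P : Fin 37 → ℂ}

theorem proj_near (hP : IsRealization P) (a b : ℤ) (i : Fin 37) :
    |(a * (P i).re + b * (P i).im) * 10 ^ 10 - proj a b i| ≤ 100 * (|(a : ℝ)| + |(b : ℝ)|) := by
  have h : (a * (P i).re + b * (P i).im) * 10 ^ 10 - proj a b i =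
      a * ((P i).re * 10 ^ 10 - X i) + b * ((P i).im * 10 ^ 10 - Y i) := by
    simp only [proj]; push_cast; ring
  rw [h]
  refine (abs_add_le _ _).trans ?_
  rw [abs_mul, abs_mul]
  have := mul_le_mul_of_nonneg_left (hP.re_near i) (abs_nonneg (a : ℝ))
  have := mul_le_mul_of_nonneg_left (hP.im_near i) (abs_nonneg (b : ℝ))
  linarith

theorem lt_of_proj_lt (hP : IsRealization P) {a b : ℤ} {i j : Fin 37}
    (h : proj a b i + 200 * (a.natAbs + b.natAbs) < proj a b j) :
    a * (P i).re + b * (P i).im < a * (P j).re + b * (P j).im := by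
  have h' : (proj a b i : ℝ) + 200 * (|(a : ℝ)| + |(b : ℝ)|) < proj a b j := by
    rw [← Int.cast_abs, ← Int.cast_abs, ← Int.natCast_natAbs, ← Int.natCast_natAbs]
    exact_mod_cast h
  have hi := abs_le.1 (hP.proj_near a b i)
  have hj := abs_le.1 (hP.proj_near a b j)
  linarith [hi.1, hi.2, hj.1, hj.2]

theorem disjoint_of_sepBelow (hP : IsRealization P) {a b : ℤ} {e f : Fin 37 × Fin 37}
    (h : SepBelow a b e f) {z : ℂ} (he : z ∈ segment ℝ (P e.1) (P e.2))
    (hf : z ∈ segment ℝ (P f.1) (P f.2)) : False := by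
  obtain ⟨h₁, h₂, h₃, h₄⟩ := h
  have h₁ := hP.lt_of_proj_lt h₁
  have h₂ := hP.lt_of_proj_lt h₂
  have h₃ := hP.lt_of_proj_lt h₃
  have h₄ := hP.lt_of_proj_lt h₄
  obtain ⟨s, t, hs, ht, hst, rfl⟩ := he
  obtain ⟨u, v, hu, hv, huv, huv'⟩ := hf
  have hre := congrArg Complex.re huv'
  have him := congrArg Complex.im huv'
  simp only [Complex.add_re, Complex.real_smul, Complex.re_ofReal_mul, Complex.add_im,
    Complex.im_ofReal_mul] at hre him
  set L : Fin 37 → ℝ := fun i => a * (P i).re + b * (P i).im with hL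
  have key : u * L f.1 + v * L f.2 = s * L e.1 + t * L e.2 := by
    simp only [hL]; linear_combination (a : ℝ) * hre + (b : ℝ) * him
  have hmax : s * L e.1 + t * L e.2 ≤ max (L e.1) (L e.2) := by
    have h := add_le_add (mul_le_mul_of_nonneg_left (le_max_left (L e.1) (L e.2)) hs)
      (mul_le_mul_of_nonneg_left (le_max_right (L e.1) (L e.2)) ht)
    rwa [← add_mul, hst, one_mul] at h
  have hmin : min (L f.1) (L f.2) ≤ u * L f.1 + v * L f.2 := by
    have h := add_le_add (mul_le_mul_of_nonneg_left (min_le_left (L f.1) (L f.2)) hu)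
      (mul_le_mul_of_nonneg_left (min_le_right (L f.1) (L f.2)) hv)
    rwa [← add_mul, huv, one_mul] at h
  have : max (L e.1) (L e.2) < min (L f.1) (L f.2) :=
    max_lt (lt_min h₁ h₂) (lt_min h₃ h₄)
  linarith

theorem cross_ne_zero (hP : IsRealization P) {i j k : Fin 37} (hj : dist (P i) (P j) = 1)
    (hk : dist (P i) (P k) = 1) (h : Transverse i j k) :
    ((P j).re - (P i).re) * ((P k).im - (P i).im) -
      ((P k).re - (P i).re) * ((P j).im - (P i).im) ≠ 0 := by
  intro h0
  have habs : (10 : ℝ) ^ 14 <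
      |((X j : ℝ) - X i) * (Y k - Y i) - (X k - X i) * (Y j - Y i)| := by
    have : ((10 ^ 14 : ℕ) : ℝ) <
        (((X j - X i) * (Y k - Y i) - (X k - X i) * (Y j - Y i)).natAbs : ℕ) := by
      exact_mod_cast h
    rw [Nat.cast_natAbs, Int.cast_abs] at this
    push_cast at this
    linarith
  have key : ∀ m, dist (P i) (P m) = 1 → |(P m).re - (P i).re| ≤ 1 ∧ |(P m).im - (P i).im| ≤ 1 := by
    intro m hm
    rw [dist_comm, Complex.dist_eq] at hm
    have h₁ := Complex.abs_re_le_norm (P m - P i)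
    have h₂ := Complex.abs_im_le_norm (P m - P i)
    rw [hm] at h₁ h₂
    exact ⟨by simpa using h₁, by simpa using h₂⟩
  obtain ⟨a₁, a₂⟩ := key j hj
  obtain ⟨a₃, a₄⟩ := key k hk
  have err : ∀ m, |((X m : ℝ) - X i) - ((P m).re - (P i).re) * 10 ^ 10| ≤ 200 ∧
      |((Y m : ℝ) - Y i) - ((P m).im - (P i).im) * 10 ^ 10| ≤ 200 := by
    intro m
    have h₁ := abs_le.1 (hP.re_near m)
    have h₂ := abs_le.1 (hP.re_near i)
    have h₃ := abs_le.1 (hP.im_near m)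
    have h₄ := abs_le.1 (hP.im_near i)
    constructor <;> rw [abs_le] <;> constructor <;>
      linarith [h₁.1, h₁.2, h₂.1, h₂.2, h₃.1, h₃.2, h₄.1, h₄.2]
  obtain ⟨e₁, e₂⟩ := err j
  obtain ⟨e₃, e₄⟩ := err k
  have prod : ∀ {p q e f : ℝ}, |p| ≤ 1 → |q| ≤ 1 → |e| ≤ 200 → |f| ≤ 200 →
      |(p * 10 ^ 10 + e) * (q * 10 ^ 10 + f) - p * q * 10 ^ 20| ≤ 10 ^ 13 := by
    intro p q e f hp hq he hf
    have : (p * 10 ^ 10 + e) * (q * 10 ^ 10 + f) - p * q * 10 ^ 20 =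
        10 ^ 10 * (p * f) + 10 ^ 10 * (e * q) + e * f := by ring
    rw [this]
    have b₁ : |p * f| ≤ 1 * 200 := by rw [abs_mul]; gcongr
    have b₂ : |e * q| ≤ 200 * 1 := by rw [abs_mul]; gcongr
    have b₃ : |e * f| ≤ 200 * 200 := by rw [abs_mul]; gcongr
    rw [abs_le] at b₁ b₂ b₃ ⊢
    constructor <;> linarith [b₁.1, b₁.2, b₂.1, b₂.2, b₃.1, b₃.2]
  have p₁ := prod a₁ a₄ e₁ e₄
  have p₂ := prod a₃ a₂ e₃ e₂
  rw [show ∀ p q : ℝ, p * 10 ^ 10 + (q - p * 10 ^ 10) = q from fun p q => by ring,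
    show ∀ p q : ℝ, p * 10 ^ 10 + (q - p * 10 ^ 10) = q from fun p q => by ring] at p₁ p₂
  rw [abs_le] at p₁ p₂
  rcases lt_abs.1 habs with h | h <;> linarith [p₁.1, p₁.2, p₂.1, p₂.2]

/-- Two transverse segments with a common endpoint meet only there. -/
theorem eq_of_mem_segments {p q r z : ℂ}
    (h : (q.re - p.re) * (r.im - p.im) - (r.re - p.re) * (q.im - p.im) ≠ 0)
    (hq : z ∈ segment ℝ p q) (hr : z ∈ segment ℝ p r) : z = p := by
  obtain ⟨s, t, hs, ht, hst, rfl⟩ := hq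
  obtain ⟨u, v, hu, hv, huv, huv'⟩ := hr
  have hre := congrArg Complex.re huv'
  have him := congrArg Complex.im huv'
  simp only [Complex.add_re, Complex.real_smul, Complex.re_ofReal_mul, Complex.add_im,
    Complex.im_ofReal_mul] at hre him
  obtain rfl : s = 1 - t := by linarith
  obtain rfl : u = 1 - v := by linarith
  have : t * ((q.re - p.re) * (r.im - p.im) - (r.re - p.re) * (q.im - p.im)) = 0 := by
    linear_combination (r.re - p.re) * him - (r.im - p.im) * hre
  obtain rfl : t = 0 := (mul_eq_zero.1 this).resolve_right h
  simp

theorem dist_nbr (hP : IsRealization P) {i j : Fin 37} (h : j ∈ nbrs i) :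
    dist (P i) (P j) = 1 := by
  rcases lt_trichotomy i j with hij | rfl | hij
  · exact hP.dist_eq_one (i, j) ((mem_edges_of_mem_nbrs i j h).resolve_left hij.not_gt)
  · exact absurd h (nbrs_irrefl i)
  · rw [dist_comm]
    exact hP.dist_eq_one (j, i)
      ((mem_edges_of_mem_nbrs j i (mem_nbrs_symm i j h)).resolve_left hij.not_gt)

/-- Two edges of the half sector meet at most in a common endpoint. -/
theorem edge_inter (hP : IsRealization P) {e f : Fin 37 × Fin 37} (he : e ∈ edges)
    (hf : f ∈ edges) {z : ℂ} (hze : z ∈ segment ℝ (P e.1) (P e.2))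
    (hzf : z ∈ segment ℝ (P f.1) (P f.2)) :
    e = f ∨ ∃ m, (m = e.1 ∨ m = e.2) ∧ (m = f.1 ∨ m = f.2) ∧ z = P m := by
  have main : ∀ ⦃e⦄, e ∈ edges → ∀ ⦃f⦄, f ∈ edges → e ≠ f →
      z ∈ segment ℝ (P e.1) (P e.2) → z ∈ segment ℝ (P f.1) (P f.2) →
      ∃ m, (m = e.1 ∨ m = e.2) ∧ (m = f.1 ∨ m = f.2) ∧ z = P m := by
    let R : Fin 37 × Fin 37 → Fin 37 × Fin 37 → Prop := fun e f => e ≠ f →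
      z ∈ segment ℝ (P e.1) (P e.2) → z ∈ segment ℝ (P f.1) (P f.2) →
      ∃ m, (m = e.1 ∨ m = e.2) ∧ (m = f.1 ∨ m = f.2) ∧ z = P m
    have : Std.Symm R := ⟨by
      intro e f h hne hf he
      obtain ⟨m, h₁, h₂, h₃⟩ := h hne.symm he hf
      exact ⟨m, h₂, h₁, h₃⟩⟩
    refine List.Pairwise.forall_of_forall (R := R) (l := edges) ?_ ?_
    · intro e _ h
      exact absurd rfl h
    · refine edges_separated.imp_of_mem ?_
      rintro ⟨i, j⟩ ⟨k, l⟩ hij hkl h - hze hzf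
      have d₁ := hP.dist_eq_one _ hij
      have d₂ := hP.dist_eq_one _ hkl
      simp only at h d₁ d₂ hze hzf ⊢
      rcases h with h | h | ⟨rfl, h⟩ | ⟨rfl, h⟩ | ⟨rfl, h⟩ | ⟨rfl, h⟩ | h | h | h | h
      · exact (hP.disjoint_of_sepBelow h hze hzf).elim
      · exact (hP.disjoint_of_sepBelow h hzf hze).elim
      · exact ⟨i, .inl rfl, .inl rfl, eq_of_mem_segments (hP.cross_ne_zero d₁ d₂ h) hze hzf⟩
      · rw [segment_symm] at hzf
        rw [dist_comm] at d₂
        exact ⟨i, .inl rfl, .inr rfl, eq_of_mem_segments (hP.cross_ne_zero d₁ d₂ h) hze hzf⟩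
      · rw [segment_symm] at hze
        rw [dist_comm] at d₁
        exact ⟨j, .inr rfl, .inl rfl, eq_of_mem_segments (hP.cross_ne_zero d₁ d₂ h) hze hzf⟩
      · rw [segment_symm] at hze hzf
        rw [dist_comm] at d₁ d₂
        exact ⟨j, .inr rfl, .inr rfl, eq_of_mem_segments (hP.cross_ne_zero d₁ d₂ h) hze hzf⟩
      · exact (hP.disjoint_of_sepBelow h hze hzf).elim
      · exact (hP.disjoint_of_sepBelow h hzf hze).elim
      · exact (hP.disjoint_of_sepBelow h hze hzf).elim
      · exact (hP.disjoint_of_sepBelow h hzf hze).elim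
  by_cases hef : e = f
  · exact .inl hef
  · exact .inr (main he hf hef hze hzf)

theorem injective (hP : IsRealization P) : Function.Injective P := by
  have main : ∀ i j, i < j → P i ≠ P j := by
    intro i j hij h
    have h₁ := abs_le.1 (hP.re_near i)
    have h₂ := abs_le.1 (hP.re_near j)
    have h₃ := abs_le.1 (hP.im_near i)
    have h₄ := abs_le.1 (hP.im_near j)
    rw [h] at h₁ h₃
    rcases vertices_separated i j hij with h | h
    · have h : (200 : ℝ) < ((X i - X j).natAbs : ℕ) := by exact_mod_cast h
      rw [Nat.cast_natAbs, Int.cast_abs] at h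
      push_cast at h
      rcases lt_abs.1 h with h | h <;> linarith
    · have h : (200 : ℝ) < ((Y i - Y j).natAbs : ℕ) := by exact_mod_cast h
      rw [Nat.cast_natAbs, Int.cast_abs] at h
      push_cast at h
      rcases lt_abs.1 h with h | h <;> linarith
  intro i j h
  rcases lt_trichotomy i j with hij | hij | hij
  · exact absurd h (main i j hij)
  · exact hij
  · exact absurd h.symm (main j i hij)

end IsRealization

theorem mirrorAngle_pos : 0 < mirrorAngle := by
  unfold mirrorAngle; positivity

theorem mirrorAngle_bounds : 0.0185 < mirrorAngle ∧ mirrorAngle < 0.0186 := by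
  unfold mirrorAngle
  constructor <;> linarith [Real.pi_gt_d4, Real.pi_lt_d4]

theorem lt_sin_mirrorAngle : 0.01858 < Real.sin mirrorAngle := by
  have h := Real.sin_gt_sub_cube mirrorAngle_pos
  have h₁ : 0.018587 < mirrorAngle := by
    unfold mirrorAngle
    linarith [Real.pi_gt_d6]
  have h₂ : mirrorAngle ^ 3 < 0.0186 ^ 3 := by
    have := mirrorAngle_bounds.2
    have := mirrorAngle_pos
    gcongr
  norm_num at *
  linarith

/-- The closed half sector between the two mirror lines, without its apex. -/
def sector : Set ℂ :=
  {z | 0 < z.re ∧ 0 ≤ z.im ∧ z.im * Real.cos mirrorAngle ≤ z.re * Real.sin mirrorAngle}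

theorem convex_sector : Convex ℝ sector := by
  rintro p ⟨h₁, h₂, h₃⟩ q ⟨k₁, k₂, k₃⟩ s t hs ht hst
  simp only [sector, Set.mem_ofPred_eq, Complex.add_re, Complex.real_smul, Complex.re_ofReal_mul,
    Complex.add_im, Complex.im_ofReal_mul]
  refine ⟨?_, by positivity, ?_⟩
  · rcases hs.eq_or_lt with rfl | hs
    · obtain rfl : t = 1 := by linarith
      simpa using k₁
    · positivity
  · linarith [mul_le_mul_of_nonneg_left h₃ hs, mul_le_mul_of_nonneg_left k₃ ht]

theorem upper_room : ∀ i : Fin 37, (8 ≤ i ∧ i < 17) ∨ 10 ^ 5 * Y i + 10 ^ 9 < 1858 * X i := by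
  decide +kernel

theorem exists_mem_nbrs : ∀ i, ∃ j, j ∈ nbrs i := by
  decide +kernel

theorem right_eq_of_mem_segment {f : ℂ →ₗ[ℝ] ℝ} {p q z : ℂ} (hp : 0 < f p) (hq : 0 ≤ f q)
    (hz : z ∈ segment ℝ p q) (h : f z = 0) : z = q := by
  obtain ⟨s, t, hs, ht, hst, rfl⟩ := hz
  rw [map_add, map_smul, map_smul, smul_eq_mul, smul_eq_mul] at h
  have : s * f p = 0 := by
    have := mul_nonneg hs hp.le
    have := mul_nonneg ht hq
    linarith
  obtain rfl : s = 0 := (mul_eq_zero.1 this).resolve_right hp.ne'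
  obtain rfl : t = 1 := by linarith
  simp

/-- A linear functional vanishing on the upper mirror line and positive below it. -/
def upperForm : ℂ →ₗ[ℝ] ℝ :=
  Real.sin mirrorAngle • Complex.reLm - Real.cos mirrorAngle • Complex.imLm

theorem upperForm_apply (z : ℂ) :
    upperForm z = z.re * Real.sin mirrorAngle - z.im * Real.cos mirrorAngle := by
  simp [upperForm]; ring

namespace IsRealization

variable {P : Fin 37 → ℂ}

theorem re_pos (hP : IsRealization P) (i : Fin 37) : 0 < (P i).re := by
  have h : ((95 * 10 ^ 10 : ℤ) : ℝ) < X i := by exact_mod_cast (X_bounds i).1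
  push_cast at h
  linarith [(abs_le.1 (hP.re_near i)).1]

theorem im_pos (hP : IsRealization P) {i : Fin 37} (hi : 8 ≤ i) : 0 < (P i).im := by
  have h : ((1000 : ℤ) : ℝ) < Y i := by exact_mod_cast Y_pos i hi
  push_cast at h
  linarith [(abs_le.1 (hP.im_near i)).1]

theorem im_nonneg (hP : IsRealization P) (i : Fin 37) : 0 ≤ (P i).im := by
  by_cases hi : 8 ≤ i
  · exact (hP.im_pos hi).le
  · exact (hP.im_eq_zero i (not_le.1 hi)).ge

theorem im_eq_zero_iff (hP : IsRealization P) (i : Fin 37) : (P i).im = 0 ↔ i < 8 :=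
  ⟨fun h => not_le.1 fun hi => (hP.im_pos hi).ne' h, hP.im_eq_zero i⟩

theorem upperForm_pos (hP : IsRealization P) {i : Fin 37} (hi : ¬ (8 ≤ i ∧ i < 17)) :
    0 < upperForm (P i) := by
  have h : ((10 ^ 5 * Y i + 10 ^ 9 : ℤ) : ℝ) < ((1858 * X i : ℤ) : ℝ) := by
    exact_mod_cast (upper_room i).resolve_left hi
  push_cast at h
  have h₁ := abs_le.1 (hP.re_near i)
  have h₂ := abs_le.1 (hP.im_near i)
  have h₃ : (P i).im * Real.cos mirrorAngle ≤ (P i).im :=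
    mul_le_of_le_one_right (hP.im_nonneg i) (Real.cos_le_one _)
  have h₄ : (P i).re * 0.01858 < (P i).re * Real.sin mirrorAngle :=
    mul_lt_mul_of_pos_left lt_sin_mirrorAngle (hP.re_pos i)
  rw [upperForm_apply]
  norm_num at h h₄ ⊢
  linarith [h₁.1, h₁.2, h₂.1, h₂.2]

theorem upperForm_eq_zero_iff (hP : IsRealization P) (i : Fin 37) :
    upperForm (P i) = 0 ↔ 8 ≤ i ∧ i < 17 := by
  constructor
  · intro h
    by_contra hi
    exact (hP.upperForm_pos hi).ne' h
  · rintro ⟨h₁, h₂⟩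
    rw [upperForm_apply, hP.mem_upper i h₁ h₂, sub_self]

theorem upperForm_nonneg (hP : IsRealization P) (i : Fin 37) : 0 ≤ upperForm (P i) := by
  by_cases hi : 8 ≤ i ∧ i < 17
  · exact ((hP.upperForm_eq_zero_iff i).2 hi).ge
  · exact (hP.upperForm_pos hi).le

theorem mem_sector (hP : IsRealization P) (i : Fin 37) : P i ∈ sector := by
  refine ⟨hP.re_pos i, hP.im_nonneg i, ?_⟩
  have := hP.upperForm_nonneg i
  rw [upperForm_apply] at this
  linarith

theorem segment_subset_sector (hP : IsRealization P) (i j : Fin 37) :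
    segment ℝ (P i) (P j) ⊆ sector :=
  convex_sector.segment_subset (hP.mem_sector i) (hP.mem_sector j)

theorem eq_or_eq_of_form_eq_zero {f : ℂ →ₗ[ℝ] ℝ}
    (hf : ∀ i, 0 ≤ f (P i)) (hf' : ∀ i, 17 ≤ i → 0 < f (P i)) {i j : Fin 37} (hij : j ∈ nbrs i)
    {z : ℂ} (hz : z ∈ segment ℝ (P i) (P j)) (h : f z = 0) : z = P i ∨ z = P j := by
  rcases inner_or_inner_of_mem_nbrs i j hij with hi | hj
  · exact .inr (right_eq_of_mem_segment (hf' i hi) (hf j) hz h)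
  · rw [segment_symm] at hz
    exact .inl (right_eq_of_mem_segment (hf' j hj) (hf i) hz h)

/-- An edge of the half sector meets the lower mirror line only in an endpoint. -/
theorem eq_or_eq_of_im_eq_zero (hP : IsRealization P) {i j : Fin 37} (hij : j ∈ nbrs i)
    {z : ℂ} (hz : z ∈ segment ℝ (P i) (P j)) (h : z.im = 0) : z = P i ∨ z = P j :=
  eq_or_eq_of_form_eq_zero (f := Complex.imLm) hP.im_nonneg
    (fun _ hi => hP.im_pos (le_trans (by decide) hi)) hij hz h

/-- An edge of the half sector meets the upper mirror line only in an endpoint. -/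
theorem eq_or_eq_of_upperForm_eq_zero (hP : IsRealization P) {i j : Fin 37} (hij : j ∈ nbrs i)
    {z : ℂ} (hz : z ∈ segment ℝ (P i) (P j)) (h : upperForm z = 0) : z = P i ∨ z = P j :=
  eq_or_eq_of_form_eq_zero hP.upperForm_nonneg
    (fun _ hi => hP.upperForm_pos fun h => hi.not_gt h.2) hij hz h

theorem abs_sub_le_one (hP : IsRealization P) {i j : Fin 37} (h : j ∈ nbrs i) :
    |(P j).re - (P i).re| ≤ 1 ∧ |(P j).im - (P i).im| ≤ 1 := by
  have hm := hP.dist_nbr h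
  rw [dist_comm, Complex.dist_eq] at hm
  have h₁ := Complex.abs_re_le_norm (P j - P i)
  have h₂ := Complex.abs_im_le_norm (P j - P i)
  rw [hm] at h₁ h₂
  exact ⟨by simpa using h₁, by simpa using h₂⟩

/-- Two edges at a vertex are not opposite to each other. -/
theorem add_ne_two_mul (hP : IsRealization P) {i j k : Fin 37} (hj : j ∈ nbrs i)
    (hk : k ∈ nbrs i) : P j + P k ≠ 2 * P i := by
  intro h
  rcases transverse_of_mem_nbrs i j hj k hk with rfl | ht
  · have : P i = P j := by linear_combination (-1 / 2 : ℂ) * h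
    exact nbrs_irrefl i (by rwa [← hP.injective this] at hj)
  · refine hP.cross_ne_zero (hP.dist_nbr hj) (hP.dist_nbr hk) ht ?_
    have hre := congrArg Complex.re h
    have him := congrArg Complex.im h
    simp at hre him
    linear_combination ((P k).im - (P i).im) * hre - ((P k).re - (P i).re) * him

/-- An edge at a vertex of the lower mirror line is not opposite to the reflection of another. -/
theorem add_conj_ne_two_mul (hP : IsRealization P) {i j k : Fin 37} (hi : i < 8)
    (hj : j ∈ nbrs i) (hk : k ∈ nbrs i) : P j + starRingEnd ℂ (P k) ≠ 2 * P i := by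
  intro h
  have hre := congrArg Complex.re h
  have him := congrArg Complex.im h
  simp [hP.im_eq_zero i hi] at hre him
  have a₁ := abs_le.1 (hP.re_near i)
  have a₂ := abs_le.1 (hP.re_near j)
  have a₃ := abs_le.1 (hP.re_near k)
  have a₄ := abs_le.1 (hP.im_near j)
  have a₅ := abs_le.1 (hP.im_near k)
  rcases (lower_mirror_not_straight i j hj k hk).resolve_left hi.not_ge with h | h
  · have h : (400 : ℝ) < ((X j + X k - 2 * X i).natAbs : ℕ) := by exact_mod_cast h
    rw [Nat.cast_natAbs, Int.cast_abs] at h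
    push_cast at h
    rcases lt_abs.1 h with h | h <;> linarith
  · have h : (200 : ℝ) < ((Y j - Y k).natAbs : ℕ) := by exact_mod_cast h
    rw [Nat.cast_natAbs, Int.cast_abs] at h
    push_cast at h
    rcases lt_abs.1 h with h | h <;> linarith

/-- The reflection in the upper mirror line. -/
def upperReflection (z : ℂ) : ℂ := Complex.exp (2 * mirrorAngle * Complex.I) * starRingEnd ℂ z

theorem exp_two_mirrorAngle : Complex.exp (2 * mirrorAngle * Complex.I) =
    ⟨Real.cos (2 * mirrorAngle), Real.sin (2 * mirrorAngle)⟩ := by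
  apply Complex.ext
  · simpa using Complex.exp_ofReal_mul_I_re (2 * mirrorAngle)
  · simpa using Complex.exp_ofReal_mul_I_im (2 * mirrorAngle)

theorem upperReflection_re (z : ℂ) : (upperReflection z).re =
    Real.cos (2 * mirrorAngle) * z.re + Real.sin (2 * mirrorAngle) * z.im := by
  rw [upperReflection, exp_two_mirrorAngle]; simp

theorem upperReflection_im (z : ℂ) : (upperReflection z).im =
    Real.sin (2 * mirrorAngle) * z.re - Real.cos (2 * mirrorAngle) * z.im := by
  rw [upperReflection, exp_two_mirrorAngle]; simp; ring

theorem upperReflection_of_upperForm_eq_zero {z : ℂ} (h : upperForm z = 0) :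
    upperReflection z = z := by
  rw [upperForm_apply] at h
  have h1 := Real.sin_sq_add_cos_sq mirrorAngle
  apply Complex.ext
  · rw [upperReflection_re, Real.cos_two_mul, Real.sin_two_mul]
    linear_combination (-2) * Real.sin mirrorAngle * h + 2 * z.re * h1
  · rw [upperReflection_im, Real.cos_two_mul, Real.sin_two_mul]
    linear_combination 2 * Real.cos mirrorAngle * h

/-- An edge at a vertex of the upper mirror line is not opposite to the reflection of another. -/
theorem add_upperReflection_ne_two_mul (hP : IsRealization P) {i j k : Fin 37} (h8 : 8 ≤ i)
    (h17 : i < 17) (hj : j ∈ nbrs i) (hk : k ∈ nbrs i) :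
    P j + upperReflection (P k) ≠ 2 * P i := by
  intro h
  have hi := upperReflection_of_upperForm_eq_zero ((hP.upperForm_eq_zero_iff i).2 ⟨h8, h17⟩)
  have hire := congrArg Complex.re hi
  have hiim := congrArg Complex.im hi
  have hre := congrArg Complex.re h
  have him := congrArg Complex.im h
  simp only [Complex.add_re, Complex.add_im, upperReflection_re, upperReflection_im]
    at hre him hire hiim
  simp only [Complex.mul_re, Complex.mul_im, Complex.re_ofNat, Complex.im_ofNat, zero_mul, sub_zero,
    add_zero] at hre him
  obtain ⟨b₁, b₂⟩ := hP.abs_sub_le_one hk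
  have ma := mirrorAngle_bounds
  set C := Real.cos (2 * mirrorAngle)
  set S := Real.sin (2 * mirrorAngle)
  have hS : |S| ≤ 0.04 := by
    refine Real.abs_sin_le_abs.trans ?_
    rw [abs_of_pos (by linarith)]
    linarith
  have hC : |1 - C| ≤ 0.001 := by
    rw [abs_of_nonneg (by linarith [Real.cos_le_one (2 * mirrorAngle)])]
    have := Real.one_sub_sq_div_two_le_cos (x := 2 * mirrorAngle)
    have : (2 * mirrorAngle) ^ 2 ≤ (2 * 0.0186) ^ 2 := by
      have := mirrorAngle_pos
      gcongr
      exact ma.2.le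
    norm_num at *
    linarith
  have e₁ : |(1 - C) * ((P k).re - (P i).re)| ≤ 0.001 * 1 := by rw [abs_mul]; gcongr
  have e₂ : |S * ((P k).im - (P i).im)| ≤ 0.04 * 1 := by rw [abs_mul]; gcongr
  have e₃ : |(1 - C) * ((P k).im - (P i).im)| ≤ 0.001 * 1 := by rw [abs_mul]; gcongr
  have e₄ : |S * ((P k).re - (P i).re)| ≤ 0.04 * 1 := by rw [abs_mul]; gcongr
  rw [abs_le] at e₁ e₂ e₃ e₄
  norm_num at e₁ e₂ e₃ e₄
  have a₁ := abs_le.1 (hP.re_near i)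
  have a₂ := abs_le.1 (hP.re_near j)
  have a₃ := abs_le.1 (hP.re_near k)
  have a₄ := abs_le.1 (hP.im_near j)
  have a₅ := abs_le.1 (hP.im_near k)
  have dx : (P j).re + (P k).re - 2 * (P i).re =
      (1 - C) * ((P k).re - (P i).re) - S * ((P k).im - (P i).im) := by
    linear_combination hre - hire
  have dy : (P j).im - (P k).im =
      - ((1 - C) * ((P k).im - (P i).im)) - S * ((P k).re - (P i).re) := by
    linear_combination him - hiim
  rcases ((upper_mirror_not_straight i j hj k hk).resolve_left h8.not_gt).resolve_left h17.not_ge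
    with h | h
  · have h : (2 * 10 ^ 9 : ℝ) < ((X j + X k - 2 * X i).natAbs : ℕ) := by exact_mod_cast h
    rw [Nat.cast_natAbs, Int.cast_abs] at h
    push_cast at h
    rcases lt_abs.1 h with h | h <;> linarith [e₁.1, e₁.2, e₂.1, e₂.2]
  · have h : (2 * 10 ^ 9 : ℝ) < ((Y j - Y k).natAbs : ℕ) := by exact_mod_cast h
    rw [Nat.cast_natAbs, Int.cast_abs] at h
    push_cast at h
    rcases lt_abs.1 h with h | h <;> linarith [e₃.1, e₃.2, e₄.1, e₄.2]

end IsRealization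

open UnitDistGraph IsRealization

/-- The symmetries of the ring: rotations `(k, false)` and reflections `(k, true)`. -/
abbrev Sym : Type := ZMod 169 × Bool

/-- The isometry of the plane that belongs to a symmetry of the ring. -/
def act (g : Sym) : ℂ ≃ₗᵢ[ℝ] ℂ :=
  (bif g.2 then Complex.conjLIE else LinearIsometryEquiv.refl ℝ ℂ).trans
    (rotation (ZMod.toCircle g.1))

theorem act_false (k : ZMod 169) (z : ℂ) : act (k, false) z = ZMod.toCircle k * z := by
  simp [act]

theorem act_true (k : ZMod 169) (z : ℂ) :
    act (k, true) z = ZMod.toCircle k * starRingEnd ℂ z := by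
  simp [act]

/-- The symmetry that agrees with `g` on the lower mirror line. -/
def lowerTwin (g : Sym) : Sym := (g.1, !g.2)

/-- The symmetry that agrees with `g` on the upper mirror line. -/
def upperTwin (g : Sym) : Sym := bif g.2 then (g.1 - 1, false) else (g.1 + 1, true)

theorem lowerTwin_ne (g : Sym) : lowerTwin g ≠ g := by
  rcases g with ⟨k, _ | _⟩ <;> simp [lowerTwin]

theorem upperTwin_ne (g : Sym) : upperTwin g ≠ g := by
  rcases g with ⟨k, _ | _⟩ <;> simp [upperTwin]

theorem toCircle_one :
    (ZMod.toCircle (1 : ZMod 169) : ℂ) = Complex.exp (2 * mirrorAngle * Complex.I) := by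
  have := ZMod.toCircle_intCast (N := 169) 1
  rw [Int.cast_one] at this
  rw [this, mirrorAngle]
  congr 1
  push_cast
  ring

theorem act_lowerTwin (g : Sym) (z : ℂ) : act (lowerTwin g) z = act g (starRingEnd ℂ z) := by
  rcases g with ⟨k, _ | _⟩ <;> simp [lowerTwin, act_false, act_true]

theorem act_upperTwin (g : Sym) (z : ℂ) : act (upperTwin g) z = act g (upperReflection z) := by
  rcases g with ⟨k, _ | _⟩
  · simp only [upperTwin, cond_false, act_false, act_true, upperReflection, AddChar.map_add_eq_mul,
      Circle.coe_mul, toCircle_one, mul_assoc]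
  · simp only [upperTwin, cond_true, act_false, act_true, upperReflection, ← toCircle_one,
      AddChar.map_sub_eq_div, map_mul, Complex.conj_conj, Circle.coe_div,
      ← Circle.coe_inv_eq_conj, Circle.coe_inv]
    ring

theorem act_lowerTwin_of_im_eq_zero (g : Sym) {z : ℂ} (h : z.im = 0) :
    act (lowerTwin g) z = act g z := by
  rw [act_lowerTwin, Complex.conj_eq_iff_im.2 h]

theorem act_upperTwin_of_upperForm_eq_zero (g : Sym) {z : ℂ} (h : upperForm z = 0) :
    act (upperTwin g) z = act g z := by
  rw [act_upperTwin, upperReflection_of_upperForm_eq_zero h]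

theorem exists_polar {z : ℂ} (hz : z ∈ sector) : ∃ θ : ℝ, 0 ≤ θ ∧ θ ≤ mirrorAngle ∧
    z = ‖z‖ * Complex.exp (θ * Complex.I) ∧ (θ = 0 → z.im = 0) ∧
    (θ = mirrorAngle → upperForm z = 0) := by
  obtain ⟨h₁, h₂, h₃⟩ := hz
  have hne : z ≠ 0 := by rintro rfl; simp at h₁
  have hn : 0 < ‖z‖ := norm_pos_iff.2 hne
  have hlt : |z.arg| < Real.pi / 2 := Complex.abs_arg_lt_pi_div_two_iff.2 (.inl h₁)
  have h0 : 0 ≤ z.arg := Complex.arg_nonneg_iff.2 h₂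
  rw [abs_of_nonneg h0] at hlt
  have hre : ‖z‖ * Real.cos z.arg = z.re := Complex.norm_mul_cos_arg z
  have him : ‖z‖ * Real.sin z.arg = z.im := Complex.norm_mul_sin_arg z
  have hform : upperForm z = ‖z‖ * Real.sin (mirrorAngle - z.arg) := by
    rw [upperForm_apply, Real.sin_sub, ← hre, ← him]; ring
  refine ⟨z.arg, h0, ?_, (Complex.norm_mul_exp_arg_mul_I z).symm, ?_, ?_⟩
  · by_contra! h
    have hneg : Real.sin (mirrorAngle - z.arg) < 0 :=
      Real.sin_neg_of_neg_of_neg_pi_lt (by linarith) (by linarith [mirrorAngle_pos, Real.pi_pos])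
    have : upperForm z < 0 := by rw [hform]; exact mul_neg_of_pos_of_neg hn hneg
    rw [upperForm_apply] at this
    linarith
  · intro h
    rw [← him, h, Real.sin_zero, mul_zero]
  · intro h
    rw [hform, h, sub_self, Real.sin_zero, mul_zero]

/-- The half sector is a fundamental domain. -/
theorem eq_of_act_eq_act {g h : Sym} {z w : ℂ} (hz : z ∈ sector) (hw : w ∈ sector)
    (he : act g z = act h w) :
    z = w ∧ (g = h ∨ (z.im = 0 ∧ h = lowerTwin g) ∨ (upperForm z = 0 ∧ h = upperTwin g)) := by
  obtain ⟨θ, θ₀, θ₁, hzθ, hz0, hz1⟩ := exists_polar hz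
  obtain ⟨η, η₀, η₁, hwη, hw0, hw1⟩ := exists_polar hw
  have hn : ‖w‖ = ‖z‖ := by
    have := congrArg norm he
    simpa using this.symm
  have hpos : (‖z‖ : ℂ) ≠ 0 := by
    have : z ≠ 0 := by rintro rfl; simpa using hz.1
    simpa using this
  rw [hn] at hwη
  have zw : θ = η → z = w := fun h => by rw [hzθ, hwη, h]
  have cexp : ∀ x : ℝ, starRingEnd ℂ (Complex.exp (x * Complex.I)) =
      Complex.exp ((-x : ℝ) * Complex.I) := fun x => by
    rw [← Complex.exp_conj]; simp
  have key : ∀ (k l : ZMod 169) (x y : ℝ),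
      (ZMod.toCircle k : ℂ) * (‖z‖ * Complex.exp (x * Complex.I)) =
        ZMod.toCircle l * (‖z‖ * Complex.exp (y * Complex.I)) →
      ∃ n : ℤ, x - y = 2 * mirrorAngle * n ∧ l = k + n := by
    intro k l x y hxy
    obtain ⟨a, rfl⟩ := ZMod.intCast_surjective k
    obtain ⟨b, rfl⟩ := ZMod.intCast_surjective l
    rw [ZMod.toCircle_intCast, ZMod.toCircle_intCast, mul_left_comm, mul_left_comm (Complex.exp _),
      mul_right_inj' hpos, ← Complex.exp_add, ← Complex.exp_add,
      Complex.exp_eq_exp_iff_exists_int] at hxy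
    obtain ⟨n, hn⟩ := hxy
    refine ⟨b - a + 169 * n, ?_, ?_⟩
    · have := congrArg Complex.im hn
      have e : ∀ (c : ℤ) (t : ℝ), 2 * (Real.pi : ℂ) * Complex.I * c / (169 : ℕ) + t * Complex.I =
          ((2 * Real.pi * c / 169 + t : ℝ) : ℂ) * Complex.I := by
        intro c t; push_cast; ring
      have e' : (n : ℂ) * (2 * Real.pi * Complex.I) =
          ((n * (2 * Real.pi) : ℝ) : ℂ) * Complex.I := by
        push_cast; ring
      rw [e, e, e', ← add_mul, ← Complex.ofReal_add, Complex.im_ofReal_mul, Complex.im_ofReal_mul,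
        Complex.I_im, mul_one, mul_one] at this
      rw [mirrorAngle]
      push_cast
      linear_combination this
    · push_cast
      have : (169 : ZMod 169) = 0 := by decide
      rw [this]; ring
  have small : ∀ n : ℤ, ∀ t : ℝ, t = 2 * mirrorAngle * n → -(2 * mirrorAngle) < t →
      t ≤ 2 * mirrorAngle → n = 0 ∨ n = 1 := by
    intro n t ht h₁ h₂
    have hm := mirrorAngle_pos
    have : (-1 : ℝ) < n := by
      by_contra! h
      nlinarith
    have : (n : ℝ) ≤ 1 := by
      by_contra! h
      nlinarith
    have : (-1 : ℤ) < n := by exact_mod_cast ‹(-1 : ℝ) < n›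
    have : n ≤ 1 := by exact_mod_cast ‹(n : ℝ) ≤ 1›
    omega
  have hm := mirrorAngle_pos
  rcases g with ⟨k, _ | _⟩ <;> rcases h with ⟨l, _ | _⟩ <;>
    simp only [act_false, act_true] at he <;> rw [hzθ, hwη] at he <;>
    try simp only [map_mul, cexp, Complex.conj_ofReal] at he
  all_goals obtain ⟨n, hn₁, hn₂⟩ := key _ _ _ _ he
  · rcases small n _ hn₁ (by linarith) (by linarith) with rfl | rfl
    · norm_num at hn₁ hn₂
      exact ⟨zw (by linarith), .inl (by rw [hn₂])⟩
    · norm_num at hn₁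
      linarith
  · rcases small n _ hn₁ (by linarith) (by linarith) with rfl | rfl
    · norm_num at hn₁ hn₂
      refine ⟨zw (by linarith), .inr (.inl ⟨hz0 (by linarith), by rw [hn₂]; rfl⟩)⟩
    · norm_num at hn₁ hn₂
      refine ⟨zw (by linarith), .inr (.inr ⟨hz1 (by linarith), by rw [hn₂]; rfl⟩)⟩
  · rcases small (-n) (-(-θ - η)) (by push_cast; linarith) (by linarith) (by linarith) with h | h
    · obtain rfl : n = 0 := by omega
      norm_num at hn₁ hn₂
      refine ⟨zw (by linarith), .inr (.inl ⟨hz0 (by linarith), by rw [hn₂]; rfl⟩)⟩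
    · obtain rfl : n = -1 := by omega
      norm_num at hn₁ hn₂
      exact ⟨zw (by linarith), .inr (.inr ⟨hz1 (by linarith), by rw [hn₂, ← sub_eq_add_neg]; rfl⟩)⟩
  · rcases small n _ hn₁ (by linarith) (by linarith) with rfl | rfl
    · norm_num at hn₁ hn₂
      exact ⟨zw (by linarith), .inl (by rw [hn₂])⟩
    · norm_num at hn₁
      linarith

namespace IsRealization

/-- The copy of the vertex `i` under the symmetry `g`. -/
def pt (P : Fin 37 → ℂ) (g : Sym) (i : Fin 37) : ℂ := act g (P i)

variable {P : Fin 37 → ℂ}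

theorem pt_lowerTwin (hP : IsRealization P) (g : Sym) {i : Fin 37} (hi : i < 8) :
    pt P (lowerTwin g) i = pt P g i :=
  act_lowerTwin_of_im_eq_zero g (hP.im_eq_zero i hi)

theorem pt_upperTwin (hP : IsRealization P) (g : Sym) {i : Fin 37} (hi : 8 ≤ i ∧ i < 17) :
    pt P (upperTwin g) i = pt P g i :=
  act_upperTwin_of_upperForm_eq_zero g ((hP.upperForm_eq_zero_iff i).2 hi)

/-- The symmetries that map the vertex `i` to the same point as `g`. -/
def twins (g : Sym) (i : Fin 37) : Finset Sym :=
  if i < 8 then {g, lowerTwin g} else if i < 17 then {g, upperTwin g} else {g}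

theorem mem_twins {g h : Sym} {i : Fin 37} : h ∈ twins g i ↔
    h = g ∨ (i < 8 ∧ h = lowerTwin g) ∨ ((8 ≤ i ∧ i < 17) ∧ h = upperTwin g) := by
  unfold twins
  split_ifs with h₁ h₂
  · simp [h₁, h₁.not_ge]
  · simp [h₁, h₂, not_lt.1 h₁]
  · simp [h₁, h₂]

theorem card_twins (g : Sym) (i : Fin 37) : (twins g i).card * (nbrs i).length = 4 := by
  rw [length_nbrs]
  unfold twins
  split_ifs with h₁ h₂ h₃
  · rw [Finset.card_pair (lowerTwin_ne g).symm]
  · exact absurd (h₁.trans (by decide)) h₂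
  · rw [Finset.card_pair (upperTwin_ne g).symm]
  · simp

theorem pt_eq_pt_iff (hP : IsRealization P) {g h : Sym} {i j : Fin 37} :
    pt P g i = pt P h j ↔ i = j ∧ h ∈ twins g i := by
  constructor
  · intro he
    obtain ⟨h₁, h₂⟩ := eq_of_act_eq_act (hP.mem_sector i) (hP.mem_sector j) he
    rw [mem_twins, ← hP.im_eq_zero_iff, ← hP.upperForm_eq_zero_iff, @eq_comm _ h g]
    exact ⟨hP.injective h₁, h₂⟩
  · rintro ⟨rfl, h⟩
    rcases mem_twins.1 h with rfl | ⟨hi, rfl⟩ | ⟨hi, rfl⟩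
    · rfl
    · exact (hP.pt_lowerTwin g hi).symm
    · exact (hP.pt_upperTwin g hi).symm

theorem eq_of_pt_eq_pt (hP : IsRealization P) {g h : Sym} {i j : Fin 37} (hi : 17 ≤ i)
    (he : pt P g i = pt P h j) : i = j ∧ g = h := by
  obtain ⟨h₁, h₂⟩ := hP.pt_eq_pt_iff.1 he
  refine ⟨h₁, ?_⟩
  rcases mem_twins.1 h₂ with h | ⟨h, -⟩ | ⟨⟨-, h⟩, -⟩
  · exact h.symm
  · exact absurd (h.trans (by decide : (8 : Fin 37) < 17)) hi.not_gt
  · exact absurd h hi.not_gt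

theorem pt_injective (hP : IsRealization P) (g : Sym) : Function.Injective (pt P g) :=
  (act g).injective.comp hP.injective

theorem dist_pt (hP : IsRealization P) (g : Sym) {i j : Fin 37} (h : j ∈ nbrs i) :
    dist (pt P g i) (pt P g j) = 1 := by
  rw [pt, pt, (act g).dist_map, hP.dist_nbr h]

theorem pt_ne_pt (hP : IsRealization P) (g : Sym) {i j : Fin 37} (h : j ∈ nbrs i) :
    pt P g i ≠ pt P g j := by
  intro he
  have := hP.dist_pt g h
  rw [he, dist_self] at this
  exact zero_ne_one this

/-- The ring graph assembled from all copies of the half sector. -/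
def ring (hP : IsRealization P) : UnitDistGraph where
  V := (Set.finite_range fun x : Sym × Fin 37 => pt P x.1 x.2).toFinset
  E := (Set.finite_range fun x : Sym × {p : Fin 37 × Fin 37 // p.2 ∈ nbrs p.1} =>
    ({pt P x.1 x.2.1.1, pt P x.1 x.2.1.2} : Finset ℂ)).toFinset
  edge_sub := by
    intro e he v hv
    rw [Set.Finite.mem_toFinset, Set.mem_range] at he ⊢
    obtain ⟨x, rfl⟩ := he
    rw [Finset.mem_insert, Finset.mem_singleton] at hv
    rcases hv with rfl | rfl
    · exact ⟨(x.1, x.2.1.1), rfl⟩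
    · exact ⟨(x.1, x.2.1.2), rfl⟩
  edge_pair := by
    intro e he
    rw [Set.Finite.mem_toFinset, Set.mem_range] at he
    obtain ⟨x, rfl⟩ := he
    exact ⟨_, _, hP.pt_ne_pt x.1 x.2.2, rfl, hP.dist_pt x.1 x.2.2⟩

theorem mem_V (hP : IsRealization P) {v : ℂ} : v ∈ hP.ring.V ↔ ∃ g i, v = pt P g i := by
  simp only [ring, Set.Finite.mem_toFinset, Set.mem_range, Prod.exists, @eq_comm _ v]

theorem mem_E (hP : IsRealization P) {e : Finset ℂ} :
    e ∈ hP.ring.E ↔ ∃ g i j, j ∈ nbrs i ∧ e = {pt P g i, pt P g j} := by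
  rw [ring, Set.Finite.mem_toFinset, Set.mem_range]
  constructor
  · rintro ⟨⟨g, ⟨i, j⟩, h⟩, rfl⟩
    exact ⟨g, i, j, h, rfl⟩
  · rintro ⟨g, i, j, h, rfl⟩
    exact ⟨(g, ⟨(i, j), h⟩), rfl⟩

theorem pair_mem_E_iff (hP : IsRealization P) {x y : ℂ} :
    {x, y} ∈ hP.ring.E ↔ ∃ g i j, j ∈ nbrs i ∧ x = pt P g i ∧ y = pt P g j := by
  rw [mem_E]
  constructor
  · rintro ⟨g, i, j, hij, h⟩
    have hne := hP.pt_ne_pt g hij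
    simp only [Finset.ext_iff, Finset.mem_insert, Finset.mem_singleton] at h
    rcases (h x).1 (.inl rfl) with hx | hx <;> rcases (h y).1 (.inr rfl) with hy | hy
    · exact absurd (((h (pt P g j)).2 (.inr rfl)).elim (·.trans hx) (·.trans hy)) hne.symm
    · exact ⟨g, i, j, hij, hx, hy⟩
    · exact ⟨g, j, i, mem_nbrs_symm i j hij, hx, hy⟩
    · exact absurd (((h (pt P g i)).2 (.inl rfl)).elim (·.trans hx) (·.trans hy)) hne
  · rintro ⟨g, i, j, hij, rfl, rfl⟩
    exact ⟨g, i, j, hij, rfl⟩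

theorem edgeSeg_pair (x y : ℂ) : edgeSeg {x, y} = segment ℝ x y := by
  rw [edgeSeg, Finset.coe_pair, convexHull_pair]

theorem segment_pt (g : Sym) (i j : Fin 37) :
    segment ℝ (pt P g i) (pt P g j) = act g '' segment ℝ (P i) (P j) :=
  (image_segment ℝ (act g).toAffineEquiv.toAffineMap (P i) (P j)).symm

theorem edge_inter_nbrs (hP : IsRealization P) {i j k l : Fin 37} (hij : j ∈ nbrs i)
    (hkl : l ∈ nbrs k) {z : ℂ} (hz : z ∈ segment ℝ (P i) (P j)) (hz' : z ∈ segment ℝ (P k) (P l)) :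
    (({i, j} : Finset (Fin 37)) = {k, l}) ∨
      ∃ m, (m = i ∨ m = j) ∧ (m = k ∨ m = l) ∧ z = P m := by
  have sorted : ∀ {i j : Fin 37}, j ∈ nbrs i → z ∈ segment ℝ (P i) (P j) →
      ∃ e ∈ edges, ({i, j} : Finset (Fin 37)) = {e.1, e.2} ∧ z ∈ segment ℝ (P e.1) (P e.2) := by
    intro i j hij hz
    rcases mem_edges_of_mem_nbrs i j hij with h | h
    · refine ⟨(j, i), ?_, Finset.pair_comm i j, by rwa [segment_symm]⟩
      exact (mem_edges_of_mem_nbrs j i (mem_nbrs_symm i j hij)).resolve_left h.not_gt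
    · exact ⟨(i, j), h, rfl, hz⟩
  obtain ⟨e, he, h₁, h₂⟩ := sorted hij hz
  obtain ⟨f, hf, h₃, h₄⟩ := sorted hkl hz'
  rcases hP.edge_inter he hf h₂ h₄ with rfl | ⟨m, h₅, h₆, h₇⟩
  · exact .inl (h₁.trans h₃.symm)
  · refine .inr ⟨m, ?_, ?_, h₇⟩
    · have : m ∈ ({i, j} : Finset (Fin 37)) := by rw [h₁]; simpa using h₅
      simpa using this
    · have : m ∈ ({k, l} : Finset (Fin 37)) := by rw [h₃]; simpa using h₆
      simpa using this

theorem edgeSeg_inter (hP : IsRealization P) {e f : Finset ℂ} (he : e ∈ hP.ring.E)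
    (hf : f ∈ hP.ring.E) (hne : e ≠ f) : edgeSeg e ∩ edgeSeg f ⊆ (e : Set ℂ) ∩ (f : Set ℂ) := by
  obtain ⟨g, i, j, hij, rfl⟩ := hP.mem_E.1 he
  obtain ⟨h, k, l, hkl, rfl⟩ := hP.mem_E.1 hf
  rintro z ⟨hz, hz'⟩
  rw [edgeSeg_pair, segment_pt] at hz hz'
  obtain ⟨x, hx, rfl⟩ := hz
  obtain ⟨y, hy, hxy⟩ := hz'
  obtain ⟨rfl, h₁⟩ := eq_of_act_eq_act (hP.segment_subset_sector i j hx)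
    (hP.segment_subset_sector k l hy) hxy.symm
  simp only [Set.mem_inter_iff, Finset.mem_coe, Finset.mem_insert, Finset.mem_singleton]
  have ends : ∀ {s : Sym} {a b : Fin 37}, act g x = act s x → (x = P a ∨ x = P b) →
      act g x = pt P s a ∨ act g x = pt P s b := by
    intro s a b hs hx
    exact hx.imp (fun h => by rw [hs, h]; rfl) (fun h => by rw [hs, h]; rfl)
  rcases h₁ with rfl | ⟨h₁, -⟩ | ⟨h₁, -⟩
  · rcases hP.edge_inter_nbrs hij hkl hx hy with h₂ | ⟨m, h₂, h₃, rfl⟩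
    · refine absurd ?_ hne
      have := congrArg (Finset.image (pt P g)) h₂
      simpa only [Finset.image_insert, Finset.image_singleton] using this
    · exact ⟨h₂.imp (congrArg (pt P g)) (congrArg (pt P g)),
        h₃.imp (congrArg (pt P g)) (congrArg (pt P g))⟩
  · exact ⟨ends rfl (hP.eq_or_eq_of_im_eq_zero hij hx h₁),
      ends hxy.symm (hP.eq_or_eq_of_im_eq_zero hkl hy h₁)⟩
  · exact ⟨ends rfl (hP.eq_or_eq_of_upperForm_eq_zero hij hx h₁),
      ends hxy.symm (hP.eq_or_eq_of_upperForm_eq_zero hkl hy h₁)⟩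

theorem planar (hP : IsRealization P) : hP.ring.Planar := by
  refine ⟨fun e he f hf hne => hP.edgeSeg_inter he hf hne, fun v hv e he hve => ?_⟩
  obtain ⟨g, i, rfl⟩ := hP.mem_V.1 hv
  obtain ⟨j, hij⟩ := exists_mem_nbrs i
  have hf : {pt P g i, pt P g j} ∈ hP.ring.E := hP.mem_E.2 ⟨g, i, j, hij, rfl⟩
  by_cases h : e = {pt P g i, pt P g j}
  · rw [h]; exact Finset.mem_insert_self _ _
  · refine (hP.edgeSeg_inter he hf h ⟨hve, ?_⟩).1
    rw [edgeSeg_pair]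
    exact left_mem_segment ℝ _ _

theorem regular4 (hP : IsRealization P) : hP.ring.Regular4 := by
  intro v hv
  obtain ⟨g, i, rfl⟩ := hP.mem_V.1 hv
  have hset : {e | e ∈ hP.ring.E ∧ pt P g i ∈ e} =
      (((twins g i ×ˢ (nbrs i).toFinset).image fun x => ({pt P g i, pt P x.1 x.2} : Finset ℂ) :
        Finset (Finset ℂ)) : Set (Finset ℂ)) := by
    ext e
    simp only [Set.mem_ofPred_eq, Finset.coe_image, Set.mem_image, Finset.mem_coe,
      Finset.mem_product, List.mem_toFinset]
    constructor
    · rintro ⟨he, hv⟩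
      obtain ⟨h, k, l, hkl, rfl⟩ := hP.mem_E.1 he
      rw [Finset.mem_insert, Finset.mem_singleton] at hv
      rcases hv with hv | hv
      · obtain ⟨rfl, hh⟩ := hP.pt_eq_pt_iff.1 hv
        exact ⟨(h, l), ⟨hh, hkl⟩, by rw [hv]⟩
      · obtain ⟨rfl, hh⟩ := hP.pt_eq_pt_iff.1 hv
        exact ⟨(h, k), ⟨hh, mem_nbrs_symm _ _ hkl⟩, by rw [hv, Finset.pair_comm]⟩
    · rintro ⟨⟨h, j⟩, ⟨hh, hj⟩, rfl⟩
      refine ⟨hP.pair_mem_E_iff.2 ⟨h, i, j, hj, hP.pt_eq_pt_iff.2 ⟨rfl, hh⟩, rfl⟩, ?_⟩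
      exact Finset.mem_insert_self _ _
  rw [UnitDistGraph.degree, hset, Set.ncard_coe_finset, Finset.card_image_of_injOn,
    Finset.card_product, List.toFinset_card_of_nodup (nbrs_nodup i), card_twins]
  rintro ⟨h, j⟩ hx ⟨h', j'⟩ hx' heq
  simp only [Finset.coe_product, Set.mem_prod, Finset.mem_coe, List.mem_toFinset] at hx hx' heq
  have hne : pt P h j ≠ pt P g i := by
    rw [hP.pt_eq_pt_iff.2 ⟨rfl, hx.1⟩]
    exact (hP.pt_ne_pt h hx.2).symm
  have hmem : pt P h j ∈ ({pt P g i, pt P h' j'} : Finset ℂ) := by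
    rw [← heq]; simp
  rw [Finset.mem_insert, Finset.mem_singleton] at hmem
  have hpt := hmem.resolve_left hne
  obtain ⟨rfl, -⟩ := hP.pt_eq_pt_iff.1 hpt
  congr 1
  rcases inner_or_inner_of_mem_nbrs i j hx.2 with hi | hj
  · have h₁ := (hP.eq_of_pt_eq_pt hi (hP.pt_eq_pt_iff.2 ⟨rfl, hx.1⟩)).2
    have h₂ := (hP.eq_of_pt_eq_pt hi (hP.pt_eq_pt_iff.2 ⟨rfl, hx'.1⟩)).2
    exact h₁.symm.trans h₂
  · exact (hP.eq_of_pt_eq_pt hj hpt).2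

theorem isUnitTriangle (hP : IsRealization P) (g : Sym) {i j k : Fin 37} (hij : j ∈ nbrs i)
    (hik : k ∈ nbrs i) (hjk : k ∈ nbrs j) :
    hP.ring.IsUnitTriangle {pt P g i, pt P g j, pt P g k} := by
  have edge : ∀ {a b : Fin 37}, b ∈ nbrs a → {pt P g a, pt P g b} ∈ hP.ring.E :=
    fun h => hP.pair_mem_E_iff.2 ⟨g, _, _, h, rfl, rfl⟩
  refine ⟨?_, ?_, ?_⟩
  · intro v hv
    simp only [Finset.mem_insert, Finset.mem_singleton] at hv
    rcases hv with rfl | rfl | rfl <;> exact hP.mem_V.2 ⟨g, _, rfl⟩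
  · exact Finset.card_eq_three.2
      ⟨_, _, _, hP.pt_ne_pt g hij, hP.pt_ne_pt g hik, hP.pt_ne_pt g hjk, rfl⟩
  · intro x hx y hy hxy
    simp only [Finset.mem_insert, Finset.mem_singleton] at hx hy
    rcases hx with rfl | rfl | rfl <;> rcases hy with rfl | rfl | rfl
    · exact absurd rfl hxy
    · exact edge hij
    · exact edge hik
    · exact edge (mem_nbrs_symm _ _ hij)
    · exact absurd rfl hxy
    · exact edge hjk
    · exact edge (mem_nbrs_symm _ _ hik)
    · exact edge (mem_nbrs_symm _ _ hjk)
    · exact absurd rfl hxy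

theorem onlyUnitTriangles (hP : IsRealization P) : hP.ring.OnlyUnitTriangles := by
  intro e he
  obtain ⟨g, i, j, hij, rfl⟩ := hP.mem_E.1 he
  obtain ⟨k, hik, hjk⟩ := exists_triangle_of_mem_nbrs i j hij
  refine ⟨_, hP.isUnitTriangle g hij hik hjk, ?_⟩
  intro v hv
  simp only [Finset.mem_insert, Finset.mem_singleton] at hv ⊢
  tauto

theorem isUnitTriangle_iff (hP : IsRealization P) {t : Finset ℂ} :
    hP.ring.IsUnitTriangle t ↔ ∃ g, ∃ c ∈ cliques, c.image (pt P g) = t := by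
  constructor
  · rintro ⟨-, hcard, hE⟩
    obtain ⟨x, y, z, hxy, hxz, hyz, rfl⟩ := Finset.card_eq_three.1 hcard
    have main : ∀ {x y z : ℂ} {g i j}, {x, z} ∈ hP.ring.E → {y, z} ∈ hP.ring.E → j ∈ nbrs i →
        17 ≤ i → x = pt P g i → y = pt P g j →
        ∃ g, ∃ c ∈ cliques, c.image (pt P g) = {x, y, z} := by
      intro x y z g i j hxz hyz hij hi hx hy
      obtain ⟨h, i', k, hik, hx', hz⟩ := hP.pair_mem_E_iff.1 hxz
      obtain ⟨rfl, rfl⟩ := hP.eq_of_pt_eq_pt hi (hx.symm.trans hx')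
      obtain ⟨h', j', k', hjk, hy', hz'⟩ := hP.pair_mem_E_iff.1 hyz
      obtain ⟨rfl, -⟩ := hP.pt_eq_pt_iff.1 (hy.symm.trans hy')
      obtain ⟨rfl, -⟩ := hP.pt_eq_pt_iff.1 (hz.symm.trans hz')
      refine ⟨g, {i, j, k}, mem_cliques hij hik hjk, ?_⟩
      simp only [Finset.image_insert, Finset.image_singleton, hx, hy, hz]
    have exy := hE x (by simp) y (by simp) hxy
    have exz := hE x (by simp) z (by simp) hxz
    have eyz := hE y (by simp) z (by simp) hyz
    obtain ⟨g, i, j, hij, hx, hy⟩ := hP.pair_mem_E_iff.1 exy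
    rcases inner_or_inner_of_mem_nbrs i j hij with hi | hj
    · exact main exz eyz hij hi hx hy
    · obtain ⟨g, c, hc, h⟩ := main eyz exz (mem_nbrs_symm _ _ hij) hj hy hx
      exact ⟨g, c, hc, h.trans (Finset.insert_comm _ _ _)⟩
  · rintro ⟨g, c, hc, rfl⟩
    simp only [cliques, List.mem_toFinset, List.mem_map] at hc
    obtain ⟨t, ht, rfl⟩ := hc
    obtain ⟨h₁, h₂, h₃⟩ := mem_nbrs_of_mem_triangles t ht
    simpa only [Finset.image_insert, Finset.image_singleton] using hP.isUnitTriangle g h₁ h₂ h₃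

theorem triangleCount (hP : IsRealization P) : hP.ring.triangleCount = 6422 := by
  have hset : {t : Finset ℂ | hP.ring.IsUnitTriangle t} =
      (fun x : Sym × Finset (Fin 37) => x.2.image (pt P x.1)) ''
        (Set.univ ×ˢ (cliques : Set (Finset (Fin 37)))) := by
    ext t
    rw [Set.mem_ofPred_eq, hP.isUnitTriangle_iff]
    constructor
    · rintro ⟨g, c, hc, rfl⟩
      exact ⟨(g, c), ⟨trivial, hc⟩, rfl⟩
    · rintro ⟨⟨g, c⟩, ⟨-, hc⟩, rfl⟩
      exact ⟨g, c, hc, rfl⟩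
  have hinj : Set.InjOn (fun x : Sym × Finset (Fin 37) => x.2.image (pt P x.1))
      (Set.univ ×ˢ (cliques : Set (Finset (Fin 37)))) := by
    rintro ⟨g, c⟩ ⟨-, hx⟩ ⟨h, d⟩ - heq
    simp only at heq
    obtain ⟨t, ht, rfl⟩ : ∃ t ∈ triangles, {t.1, t.2.1, t.2.2} = c := by
      simpa only [cliques, Finset.mem_coe, List.mem_toFinset, List.mem_map] using hx
    have hmem : pt P g t.2.1 ∈ d.image (pt P h) := by
      rw [← heq]
      exact Finset.mem_image_of_mem _ (by simp)
    obtain ⟨j, -, hj⟩ := Finset.mem_image.1 hmem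
    obtain ⟨-, rfl⟩ := hP.eq_of_pt_eq_pt (inner_of_mem_triangles t ht) hj.symm
    rw [Finset.image_injective (hP.pt_injective g) heq]
  rw [UnitDistGraph.triangleCount, hset, hinj.ncard_image, Set.ncard_prod,
    Set.ncard_univ, Set.ncard_coe_finset, card_cliques, Nat.card_prod, Nat.card_zmod,
    Nat.card_eq_fintype_card, Fintype.card_bool]

/-- Two edges at a vertex of the ring are not opposite to each other. -/
theorem not_opposite (hP : IsRealization P) {x v y : ℂ} (hx : {v, x} ∈ hP.ring.E)
    (hy : {v, y} ∈ hP.ring.E) : x + y ≠ 2 * v := by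
  obtain ⟨g, i, j, hj, rfl, rfl⟩ := hP.pair_mem_E_iff.1 hx
  obtain ⟨h, i', k, hk, hv, rfl⟩ := hP.pair_mem_E_iff.1 hy
  obtain ⟨rfl, hh⟩ := hP.pt_eq_pt_iff.1 hv
  have pull : ∀ w : ℂ, act g (P j) + act g w = 2 * act g (P i) → P j + w = 2 * P i := by
    intro w hw
    apply (act g).injective
    rw [map_add, hw, two_mul, two_mul, map_add]
  rcases mem_twins.1 hh with rfl | ⟨hi, rfl⟩ | ⟨hi, rfl⟩
  · exact fun h => hP.add_ne_two_mul hj hk (pull _ h)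
  · rw [pt, pt, act_lowerTwin]
    exact fun h => hP.add_conj_ne_two_mul hi hj hk (pull _ h)
  · rw [pt, pt, act_upperTwin]
    exact fun h => hP.add_upperReflection_ne_two_mul hi.1 hi.2 hj hk (pull _ h)

end IsRealization

theorem isClosed_edgeSeg (e : Finset ℂ) : IsClosed (edgeSeg e) :=
  (e.finite_toSet.isCompact_convexHull ℝ).isClosed

/-- If `v` lies strictly inside a covered side, then some covering edge starts at `v` in the
direction of `y`. -/
theorem exists_edge_beyond {G : UnitDistGraph} (hG : G.Planar) {S : Finset (Finset ℂ)}
    (hS : S ⊆ G.E) {x y v : ℂ} (hv : v ∈ G.V) (hcov : segment ℝ x y = ⋃ e ∈ S, edgeSeg e)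
    (hvs : v ∈ segment ℝ x y) (hvy : v ≠ y) :
    ∃ w, {v, w} ∈ S ∧ ∃ r : ℝ, 0 < r ∧ w - v = r • (y - v) := by
  set bad : Set ℂ := ⋃ e ∈ S.filter fun e => v ∉ e, edgeSeg e
  have hbad : IsClosed bad := (Finset.finite_toSet _).isClosed_biUnion fun e _ => isClosed_edgeSeg e
  have hvbad : v ∉ bad := by
    simp only [bad, Set.mem_iUnion, not_exists]
    intro e he hve
    rw [Finset.mem_filter] at he
    exact he.2 (hG.2 v hv e (hS he.1) hve)
  have hcont : Filter.Tendsto (fun t : ℝ => v + t • (y - v))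
      (nhdsWithin 0 (Set.Ioi 0)) (nhds v) := by
    have : Continuous fun t : ℝ => v + t • (y - v) := by fun_prop
    simpa using (this.tendsto 0).mono_left nhdsWithin_le_nhds
  have hlt : ∀ᶠ t : ℝ in nhdsWithin 0 (Set.Ioi 0), t < 1 :=
    nhdsWithin_le_nhds (Iio_mem_nhds one_pos)
  obtain ⟨t, ⟨ht, ht1⟩, ht0⟩ := ((hcont.eventually (hbad.isOpen_compl.mem_nhds hvbad)).and
    hlt |>.and self_mem_nhdsWithin).exists
  have ht0 : 0 < t := ht0
  have hmem : v + t • (y - v) ∈ segment ℝ x y := by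
    refine (convex_segment x y).segment_subset hvs (right_mem_segment ℝ x y) ?_
    exact ⟨1 - t, t, by linarith, ht0.le, by ring, by
      simp only [Complex.real_smul]; push_cast; ring⟩
  rw [hcov] at hmem
  simp only [Set.mem_iUnion] at hmem
  obtain ⟨e, he, hte⟩ := hmem
  have hve : v ∈ e := by
    by_contra hve
    exact ht (Set.mem_biUnion (Finset.mem_coe.2 (Finset.mem_filter.2 ⟨he, hve⟩)) hte)
  obtain ⟨a, b, -, rfl, -⟩ := G.edge_pair e (hS he)
  obtain ⟨w, hw⟩ : ∃ w, ({a, b} : Finset ℂ) = {v, w} := by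
    rw [Finset.mem_insert, Finset.mem_singleton] at hve
    rcases hve with rfl | rfl
    · exact ⟨b, rfl⟩
    · exact ⟨a, Finset.pair_comm _ _⟩
  rw [hw] at he hte
  refine ⟨w, he, ?_⟩
  rw [edgeSeg_pair] at hte
  obtain ⟨p, q, hp, hq, hpq, h⟩ := hte
  obtain rfl : p = 1 - q := by linarith
  have h : (q : ℂ) * (w - v) = t * (y - v) := by
    simp only [Complex.real_smul] at h
    push_cast at h
    linear_combination h
  have hq0 : q ≠ 0 := by
    rintro rfl
    rw [Complex.ofReal_zero, zero_mul, eq_comm, mul_eq_zero, Complex.ofReal_eq_zero,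
      sub_eq_zero] at h
    exact h.elim ht0.ne' hvy.symm
  refine ⟨t / q, div_pos ht0 (lt_of_le_of_ne hq hq0.symm), ?_⟩
  rw [Complex.real_smul, Complex.ofReal_div]
  have : (q : ℂ) ≠ 0 := by exact_mod_cast hq0
  field_simp
  linear_combination h

theorem dist_eq_one_of_mem_E {G : UnitDistGraph} {x y : ℂ} (h : {x, y} ∈ G.E) : dist x y = 1 := by
  obtain ⟨a, b, hab, heq, hd⟩ := G.edge_pair _ h
  have ha : a ∈ ({x, y} : Finset ℂ) := by rw [heq]; simp
  have hb : b ∈ ({x, y} : Finset ℂ) := by rw [heq]; simp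
  rw [Finset.mem_insert, Finset.mem_singleton] at ha hb
  rcases ha with rfl | rfl <;> rcases hb with rfl | rfl
  · exact absurd rfl hab
  · exact hd
  · rw [dist_comm]; exact hd
  · exact absurd rfl hab

theorem dist_eq_one_of_sideCovered {G : UnitDistGraph} (hG : G.Planar)
    (hopp : ∀ x v y, {v, x} ∈ G.E → {v, y} ∈ G.E → x + y ≠ 2 * v) {x y : ℂ} (hx : x ∈ G.V)
    (hxy : x ≠ y) (hc : G.SideCovered x y) : dist x y = 1 := by
  obtain ⟨S, hS, hcov⟩ := hc
  obtain ⟨v, hvS, r, hr, hv⟩ := exists_edge_beyond hG hS hx hcov (left_mem_segment ℝ x y) hxy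
  have hE := hS hvS
  have hd := dist_eq_one_of_mem_E hE
  by_cases hvy : v = y
  · rwa [← hvy]
  have hvV : v ∈ G.V := G.edge_sub _ hE (by simp)
  have hvs : v ∈ segment ℝ x y := by
    rw [hcov]
    refine Set.mem_biUnion (Finset.mem_coe.2 hvS) ?_
    rw [edgeSeg_pair]
    exact right_mem_segment ℝ x v
  obtain ⟨w, hwS, s, hs, hw⟩ := exists_edge_beyond hG hS hvV hcov hvs hvy
  have hd' := dist_eq_one_of_mem_E (hS hwS)
  obtain ⟨p, q, hp, hq, hpq, h⟩ := hvs
  obtain rfl : q = 1 - p := by linarith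
  simp only [Complex.real_smul] at hv hw h
  push_cast at h
  have hne : (y : ℂ) - x ≠ 0 := sub_ne_zero.2 hxy.symm
  have hrq : (r : ℂ) = 1 - p := by
    have : (r - (1 - p) : ℂ) * (y - x) = 0 := by linear_combination -h - hv
    linear_combination (mul_eq_zero.1 this).resolve_right hne
  have hp0 : p ≠ 0 := by
    rintro rfl
    apply hvy
    rw [← h]; simp
  have hpos : 0 < p := lt_of_le_of_ne hp hp0.symm
  have hwv : w - v = ((s * p / r : ℝ) : ℂ) * (v - x) := by
    have hr0 : (r : ℂ) ≠ 0 := by exact_mod_cast hr.ne'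
    rw [hw, hv]
    push_cast
    field_simp
    linear_combination (s : ℂ) * h
  have hn : ‖v - x‖ = 1 := by rw [← dist_eq_norm, dist_comm]; exact hd
  have hn' : ‖w - v‖ = 1 := by rw [← dist_eq_norm, dist_comm]; exact hd'
  have hk : s * p / r = 1 := by
    rw [hwv, norm_mul, hn, mul_one, Complex.norm_real, Real.norm_of_nonneg (by positivity)] at hn'
    exact hn'
  rw [hk, Complex.ofReal_one, one_mul] at hwv
  refine absurd ?_ (hopp x v w (by rwa [Finset.pair_comm]) (hS hwS))
  linear_combination hwv

namespace IsRealization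

variable {P : Fin 37 → ℂ}

theorem noAdditionalTriangles (hP : IsRealization P) : hP.ring.NoAdditionalTriangles := by
  intro x hx y _ z _ hxy _ _ _ _ hc _ _
  exact dist_eq_one_of_sideCovered hP.planar (fun _ _ _ => hP.not_opposite) hx hxy hc

theorem rot_act (g : Sym) (z : ℂ) :
    rot 0 (2 * Real.pi / 169) (act g z) = act (g.1 + 1, g.2) z := by
  have h : Complex.exp ((2 * Real.pi / 169 : ℝ) * Complex.I) = ZMod.toCircle (1 : ZMod 169) := by
    rw [toCircle_one, mirrorAngle]
    congr 1
    push_cast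
    ring
  rw [rot, h]
  rcases g with ⟨k, _ | _⟩ <;>
    simp only [act_false, act_true, AddChar.map_add_eq_mul, Circle.coe_mul] <;> ring

theorem rotInvariant (hP : IsRealization P) : hP.ring.RotInvariant 0 (2 * Real.pi / 169) := by
  have hpt : ∀ g i, rot 0 (2 * Real.pi / 169) (pt P g i) = pt P (g.1 + 1, g.2) i :=
    fun g i => rot_act g (P i)
  have hpt' : ∀ g i, rot 0 (2 * Real.pi / 169) (pt P (g.1 - 1, g.2) i) = pt P g i := by
    intro g i
    rw [hpt, sub_add_cancel]
  constructor
  · ext v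
    simp only [Set.mem_image, Finset.mem_coe, hP.mem_V]
    constructor
    · rintro ⟨_, ⟨g, i, rfl⟩, rfl⟩
      exact ⟨_, i, hpt g i⟩
    · rintro ⟨g, i, rfl⟩
      exact ⟨_, ⟨_, i, rfl⟩, hpt' g i⟩
  · ext e
    simp only [Set.mem_image, Finset.mem_coe, hP.mem_E]
    constructor
    · rintro ⟨_, ⟨g, i, j, hij, rfl⟩, rfl⟩
      refine ⟨(g.1 + 1, g.2), i, j, hij, ?_⟩
      rw [Finset.image_insert, Finset.image_singleton, hpt, hpt]
    · rintro ⟨g, i, j, hij, rfl⟩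
      refine ⟨_, ⟨(g.1 - 1, g.2), i, j, hij, rfl⟩, ?_⟩
      rw [Finset.image_insert, Finset.image_singleton, hpt', hpt']

end IsRealization

/-- A map of a Banach space that approximates the identity on a ball around `0` and is small at
`0` has a zero in that ball. -/
theorem exists_zero_of_near_id {E : Type*} [NormedAddCommGroup E] [NormedSpace ℝ E]
    [CompleteSpace E] {f : E → E} {ε : ℝ} (hε : 0 ≤ ε)
    (hf : ∀ x y, ‖x‖ ≤ ε → ‖y‖ ≤ ε → ‖f x - f y - (x - y)‖ ≤ 1 / 2 * ‖x - y‖)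
    (h0 : ‖f 0‖ ≤ ε / 2) : ∃ x, ‖x‖ ≤ ε ∧ f x = 0 := by
  have happ : ApproximatesLinearOn f (ContinuousLinearMap.id ℝ E) (Metric.closedBall 0 ε)
      (1 / 2 : NNReal) := by
    intro x hx y hy
    have := hf x y (mem_closedBall_zero_iff.1 hx) (mem_closedBall_zero_iff.1 hy)
    simpa using this
  let g : (ContinuousLinearMap.id ℝ E).NonlinearRightInverse :=
    { toFun := id, nnnorm := 1, bound' := by simp, right_inv' := by simp }
  have h := happ.surjOn_closedBall_of_nonlinearRightInverse g hε subset_rfl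
  obtain ⟨x, hx, hfx⟩ := h (show (0 : E) ∈ _ by
    rw [mem_closedBall_iff_norm, zero_sub, norm_neg]
    refine h0.trans (le_of_eq ?_)
    simp only [g]
    norm_num
    ring)
  exact ⟨x, mem_closedBall_zero_iff.1 hx, hfx⟩

theorem abs_mul_sub_mul_le {a b a₀ b₀ δ η : ℝ} (ha : |a - a₀| ≤ δ) (hb : |b - b₀| ≤ η)
    (ha₀ : |a₀| ≤ 1) (hb₀ : |b₀| ≤ 1) (hδ : δ ≤ 1) : |a * b - a₀ * b₀| ≤ δ + 2 * η := by
  have h : a * b - a₀ * b₀ = (a - a₀) * b₀ + a * (b - b₀) := by ring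
  have ha2 : |a| ≤ 2 := by
    have := abs_sub_abs_le_abs_sub a a₀
    linarith
  rw [h]
  refine (abs_add_le _ _).trans ?_
  rw [abs_mul, abs_mul]
  have hδ0 := (abs_nonneg _).trans ha
  have h1 : |a - a₀| * |b₀| ≤ δ * 1 := mul_le_mul ha hb₀ (abs_nonneg _) hδ0
  have h2 : |a| * |b - b₀| ≤ 2 * η := mul_le_mul ha2 hb (abs_nonneg _) (by norm_num)
  linarith

theorem abs_mul_sub_le {a a₀ d δ M : ℝ} (ha : |a - a₀| ≤ δ) (hd : |d| ≤ M) :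
    |a * d - a₀ * d| ≤ δ * M := by
  rw [← sub_mul, abs_mul]
  exact mul_le_mul ha hd (abs_nonneg _) ((abs_nonneg _).trans ha)

theorem sqrt_three_div_two_near : |√3 / 2 - 0.866025403784438647| ≤ 0.0000000000000001 := by
  have h1 : (1.73205080756887719 : ℝ) ≤ √3 := Real.le_sqrt_of_sq_le (by norm_num)
  have h2 : √3 ≤ 1.73205080756887739 := Real.sqrt_le_iff.2 ⟨by norm_num, by norm_num⟩
  rw [abs_le]
  constructor <;> linarith

theorem exp_mirrorAngle_near :
    |Real.cos mirrorAngle - 0.999827223833360591| ≤ 0.000000000000001 ∧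
      |Real.sin mirrorAngle - 0.018588235033887944| ≤ 0.000000000000001 := by
  set x : ℝ := mirrorAngle with hx
  have hl : (0.018589305642543155 : ℝ) ≤ x := by
    have := Real.pi_gt_d20
    rw [hx, mirrorAngle]; linarith
  have hu : x ≤ 0.018589305642543156 := by
    have := Real.pi_lt_d20
    rw [hx, mirrorAngle]; linarith
  have h0 : 0 ≤ x := by linarith
  have hn : ‖(x * Complex.I : ℂ)‖ = x := by simp [abs_of_nonneg h0]
  have h := Complex.exp_bound' (x := x * Complex.I) (n := 8) (by rw [hn]; norm_num; linarith)
  rw [hn] at h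
  have hsmall : x ^ 8 / (Nat.factorial 8) * 2 ≤ 0.0000000000000001 := by
    have : x ^ 8 ≤ 0.02 ^ 8 := pow_le_pow_left₀ h0 (by linarith) 8
    norm_num [Nat.factorial] at this ⊢
    linarith
  have hsum : ∑ m ∈ Finset.range 8, (x * Complex.I : ℂ) ^ m / m.factorial =
      ((1 - x ^ 2 / 2 + x ^ 4 / 24 - x ^ 6 / 720 : ℝ) : ℂ) +
        ((x - x ^ 3 / 6 + x ^ 5 / 120 - x ^ 7 / 5040 : ℝ) : ℂ) * Complex.I := by
    have h2 := Complex.I_sq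
    have h3 : Complex.I ^ 3 = -Complex.I := Complex.I_pow_three
    have h4 : Complex.I ^ 4 = 1 := Complex.I_pow_four
    have h5 : Complex.I ^ 5 = Complex.I := by rw [pow_succ, h4, one_mul]
    have h6 : Complex.I ^ 6 = -1 := by rw [pow_succ, h5, Complex.I_mul_I]
    have h7 : Complex.I ^ 7 = -Complex.I := by rw [pow_succ, h6, neg_one_mul]
    simp only [Finset.sum_range_succ, Finset.sum_range_zero, mul_pow, h2, h3, h4, h5, h6, h7,
      Nat.factorial]
    push_cast
    ring
  rw [hsum] at h
  have hp : ∀ n, (0.018589305642543155 : ℝ) ^ n ≤ x ^ n ∧ x ^ n ≤ 0.018589305642543156 ^ n :=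
    fun n => ⟨pow_le_pow_left₀ (by norm_num) hl n, pow_le_pow_left₀ h0 hu n⟩
  have p2 := hp 2
  have p3 := hp 3
  have p4 := hp 4
  have p5 := hp 5
  have p6 := hp 6
  have p7 := hp 7
  norm_num at p2 p3 p4 p5 p6 p7
  have hre := ((Complex.abs_re_le_norm _).trans h).trans hsmall
  have him := ((Complex.abs_im_le_norm _).trans h).trans hsmall
  simp only [Complex.sub_re, Complex.add_re, Complex.re_ofReal_mul, Complex.ofReal_re,
    Complex.I_re, Complex.exp_ofReal_mul_I_re, mul_zero, add_zero] at hre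
  simp only [Complex.sub_im, Complex.add_im, Complex.im_ofReal_mul, Complex.ofReal_im,
    Complex.I_im, Complex.exp_ofReal_mul_I_im, mul_one, zero_add] at him
  rw [abs_le] at hre him
  constructor <;> rw [abs_le] <;> constructor <;> linarith

/-- The left hand sides of the equations which say that the half sector closes up. Here `c`, `s`
and `q` stand for the cosine and sine of the mirror angle and for `√3 / 2`, and the unknowns are
the coordinates of three of the edge vectors. -/
def closing (c s q : ℝ) (u : Fin 6 → ℝ) : Fin 6 → ℝ :=
  ![u 0 ^ 2 + u 1 ^ 2 - 1,
    u 2 ^ 2 + u 3 ^ 2 - 1,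
    u 4 ^ 2 + u 5 ^ 2 - 1,
    (7 * (c * u 2) + s * u 3 - 7 * u 0) ^ 2 + (7 * (s * u 2) - c * u 3 - u 1) ^ 2 - 1,
    u 1 / 2 - q * u 0 + (7 * (s * u 2) - c * u 3 - u 1) / 2 +
      q * (7 * (c * u 2) + s * u 3 - 7 * u 0) + 2 * (s * u 4),
    -(u 3 / 2 - q * u 2) - ((7 * (s * u 0) - c * u 1 - u 3) / 2 -
      q * (7 * u 2 - 7 * (c * u 0) - s * u 1)) + (u 5 - 2 * (q * u 4))]

/-- An affine chart around an approximate zero of `closing` in which the derivative of `closing`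
is close to the identity. -/
def chart (v : Fin 6 → ℝ) : Fin 6 → ℝ :=
  ![
    -0.866041216768190411 - 0.110 * v 0 - 0.427 * v 1 + 0.001 * v 2 + 0.102 * v 3 + 0.057 * v 4,
    -0.499972610108466071 - 0.810 * v 0 + 0.739 * v 1 - 0.002 * v 2 - 0.177 * v 3 - 0.099 * v 4,
    -0.986356792911330554 - 0.084 * v 0 - 0.490 * v 1 + 0.003 * v 2 + 0.078 * v 3 + 0.155 * v 4,
    -0.164621617892895745 + 0.504 * v 0 - 0.099 * v 1 - 0.019 * v 2 - 0.470 * v 3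
      - 0.928 * v 4 + 0.001 * v 5,
    -0.999226197614280934 + 0.013 * v 0 + 0.018 * v 1 - 0.538 * v 2 + 0.007 * v 3
      - 0.028 * v 4 + 0.042 * v 5,
    0.039331997169047852 + 0.326 * v 0 + 0.458 * v 1 - 0.945 * v 2 + 0.181 * v 3
      - 0.723 * v 4 + 1.074 * v 5]

theorem norm_closing_chart_zero_le {c s q : ℝ} (hc : |c - 0.999827223833360591| ≤ 0.000000000000001)
    (hs : |s - 0.018588235033887944| ≤ 0.000000000000001)
    (hq : |q - 0.866025403784438647| ≤ 0.000000000000001) :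
    ‖closing c s q (chart 0)‖ ≤ 0.000000000001 / 2 := by
  have hx : |7 * (c * (-0.986356792911330554)) + s * (-0.164621617892895745)
      - 7 * (-0.866041216768190411) - (-0.8440761257077073)| ≤ 0.00000000000002 := by
    rw [abs_le] at *; constructor <;> linarith
  have hy : |7 * (s * (-0.986356792911330554)) - c * (-0.164621617892895745)
      - (-0.499972610108466071) - 0.5362233620519221| ≤ 0.00000000000002 := by
    rw [abs_le] at *; constructor <;> linarith
  have hux : |7 * (-0.986356792911330554) - 7 * (c * (-0.866041216768190411))
      - s * (-0.499972610108466071) - (-0.8339628435858730)| ≤ 0.00000000000002 := by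
    rw [abs_le] at *; constructor <;> linarith
  have hx2 := abs_mul_sub_mul_le hx hx (by norm_num [abs_le]) (by norm_num [abs_le]) (by norm_num)
  have hy2 := abs_mul_sub_mul_le hy hy (by norm_num [abs_le]) (by norm_num [abs_le]) (by norm_num)
  have hqx := abs_mul_sub_mul_le hq hx (by norm_num [abs_le]) (by norm_num [abs_le]) (by norm_num)
  have hqu := abs_mul_sub_mul_le hq hux (by norm_num [abs_le]) (by norm_num [abs_le]) (by norm_num)
  rw [pi_norm_le_iff_of_nonneg (by norm_num)]
  rw [abs_le] at *
  obtain ⟨c1, c2⟩ := hc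
  obtain ⟨s1, s2⟩ := hs
  obtain ⟨q1, q2⟩ := hq
  intro i
  rw [Real.norm_eq_abs, abs_le]
  fin_cases i <;> simp [closing, chart, pow_two] <;> norm_num at * <;> constructor <;> linarith

theorem chart_near {v : Fin 6 → ℝ} (hv : ‖v‖ ≤ 0.000000000001) :
    |chart v 0 - (-0.866041216768190411)| ≤ 0.000000000004 ∧
    |chart v 1 - (-0.499972610108466071)| ≤ 0.000000000004 ∧
    |chart v 2 - (-0.986356792911330554)| ≤ 0.000000000004 ∧
    |chart v 3 - (-0.164621617892895745)| ≤ 0.000000000004 ∧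
    |chart v 4 - (-0.999226197614280934)| ≤ 0.000000000004 ∧
    |chart v 5 - 0.039331997169047852| ≤ 0.000000000004 := by
  have h : ∀ i, -0.000000000001 ≤ v i ∧ v i ≤ 0.000000000001 := fun i =>
    abs_le.1 ((norm_le_pi_norm v i).trans hv)
  obtain ⟨a0, b0⟩ := h 0
  obtain ⟨a1, b1⟩ := h 1
  obtain ⟨a2, b2⟩ := h 2
  obtain ⟨a3, b3⟩ := h 3
  obtain ⟨a4, b4⟩ := h 4
  obtain ⟨a5, b5⟩ := h 5
  simp only [chart, abs_le, Matrix.cons_val]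
  refine ⟨⟨?_, ?_⟩, ⟨?_, ?_⟩, ⟨?_, ?_⟩, ⟨?_, ?_⟩, ⟨?_, ?_⟩, ⟨?_, ?_⟩⟩ <;> linarith

theorem abs_sq_sub_sq_sub_le {a b m δ M : ℝ} (ha : |a - m| ≤ δ) (hb : |b - m| ≤ δ)
    (h : |a - b| ≤ M) : |a ^ 2 - b ^ 2 - 2 * m * (a - b)| ≤ 2 * δ * M := by
  have h1 : a ^ 2 - b ^ 2 - 2 * m * (a - b) = (a + b) * (a - b) - 2 * m * (a - b) := by ring
  rw [h1]
  refine abs_mul_sub_le ?_ h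
  rw [abs_le] at *
  constructor <;> linarith

/-- The coordinates of the innermost edge between the two triangle strips. -/
theorem inner_edge_near {c s : ℝ} {v : Fin 6 → ℝ}
    (hc : |c - 0.999827223833360591| ≤ 0.000000000000001)
    (hs : |s - 0.018588235033887944| ≤ 0.000000000000001)
    (k0 : |v 0 - (-0.866041216768190411)| ≤ 0.000000000004)
    (k1 : |v 1 - (-0.499972610108466071)| ≤ 0.000000000004)
    (k2 : |v 2 - (-0.986356792911330554)| ≤ 0.000000000004)
    (k3 : |v 3 - (-0.164621617892895745)| ≤ 0.000000000004) :
    |7 * (c * v 2) + s * v 3 - 7 * v 0 - (-0.8440761257077073)| ≤ 0.0000000001 ∧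
      |7 * (s * v 2) - c * v 3 - v 1 - 0.5362233620519221| ≤ 0.0000000001 := by
  have m0 := abs_mul_sub_mul_le hc k2 (by norm_num [abs_le]) (by norm_num [abs_le])
    (by norm_num)
  have m1 := abs_mul_sub_mul_le hs k3 (by norm_num [abs_le]) (by norm_num [abs_le])
    (by norm_num)
  have m2 := abs_mul_sub_mul_le hs k2 (by norm_num [abs_le]) (by norm_num [abs_le])
    (by norm_num)
  have m3 := abs_mul_sub_mul_le hc k3 (by norm_num [abs_le]) (by norm_num [abs_le])
    (by norm_num)
  simp only [abs_le] at *
  refine ⟨⟨?_, ?_⟩, ⟨?_, ?_⟩⟩ <;> linarith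

set_option maxHeartbeats 1600000 in
theorem closing_chart_near_id {c s q : ℝ} (hc : |c - 0.999827223833360591| ≤ 0.000000000000001)
    (hs : |s - 0.018588235033887944| ≤ 0.000000000000001)
    (hq : |q - 0.866025403784438647| ≤ 0.000000000000001)
    {x y : Fin 6 → ℝ} (hx : ‖x‖ ≤ 0.000000000001) (hy : ‖y‖ ≤ 0.000000000001) :
    ‖closing c s q (chart x) - closing c s q (chart y) - (x - y)‖ ≤ 1 / 2 * ‖x - y‖ := by
  obtain ⟨hA, hB, hC, hD, hg, hh⟩ := chart_near hx
  obtain ⟨hA', hB', hC', hD', hg', hh'⟩ := chart_near hy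
  set N := ‖x - y‖ with hN
  have hd : ∀ i, -N ≤ x i - y i ∧ x i - y i ≤ N := fun i => abs_le.1 (norm_le_pi_norm (x - y) i)
  have hN0 : 0 ≤ N := norm_nonneg _
  obtain ⟨a0, b0⟩ := hd 0
  obtain ⟨a1, b1⟩ := hd 1
  obtain ⟨a2, b2⟩ := hd 2
  obtain ⟨a3, b3⟩ := hd 3
  obtain ⟨a4, b4⟩ := hd 4
  obtain ⟨a5, b5⟩ := hd 5
  have e0 : chart x 0 - chart y 0 = -0.110 * (x 0 - y 0) - 0.427 * (x 1 - y 1)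
      + 0.001 * (x 2 - y 2) + 0.102 * (x 3 - y 3) + 0.057 * (x 4 - y 4) := by
    simp only [chart, Matrix.cons_val]; ring
  have e1 : chart x 1 - chart y 1 = -0.810 * (x 0 - y 0) + 0.739 * (x 1 - y 1)
      - 0.002 * (x 2 - y 2) - 0.177 * (x 3 - y 3) - 0.099 * (x 4 - y 4) := by
    simp only [chart, Matrix.cons_val]; ring
  have e2 : chart x 2 - chart y 2 = -0.084 * (x 0 - y 0) - 0.490 * (x 1 - y 1)
      + 0.003 * (x 2 - y 2) + 0.078 * (x 3 - y 3) + 0.155 * (x 4 - y 4) := by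
    simp only [chart, Matrix.cons_val]; ring
  have e3 : chart x 3 - chart y 3 = 0.504 * (x 0 - y 0) - 0.099 * (x 1 - y 1)
      - 0.019 * (x 2 - y 2) - 0.470 * (x 3 - y 3) - 0.928 * (x 4 - y 4)
      + 0.001 * (x 5 - y 5) := by
    simp only [chart, Matrix.cons_val]; ring
  have e4 : chart x 4 - chart y 4 = 0.013 * (x 0 - y 0) + 0.018 * (x 1 - y 1)
      - 0.538 * (x 2 - y 2) + 0.007 * (x 3 - y 3) - 0.028 * (x 4 - y 4)
      + 0.042 * (x 5 - y 5) := by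
    simp only [chart, Matrix.cons_val]; ring
  have e5 : chart x 5 - chart y 5 = 0.326 * (x 0 - y 0) + 0.458 * (x 1 - y 1)
      - 0.945 * (x 2 - y 2) + 0.181 * (x 3 - y 3) - 0.723 * (x 4 - y 4)
      + 1.074 * (x 5 - y 5) := by
    simp only [chart, Matrix.cons_val]; ring
  generalize chart x = u at *
  generalize chart y = w at *
  have d0 : |u 0 - w 0| ≤ 2 * N := by rw [e0, abs_le]; constructor <;> linarith
  have d1 : |u 1 - w 1| ≤ 2 * N := by rw [e1, abs_le]; constructor <;> linarith
  have d2 : |u 2 - w 2| ≤ 2 * N := by rw [e2, abs_le]; constructor <;> linarith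
  have d3 : |u 3 - w 3| ≤ 4 * N := by rw [e3, abs_le]; constructor <;> linarith
  have d4 : |u 4 - w 4| ≤ 2 * N := by rw [e4, abs_le]; constructor <;> linarith
  have d5 : |u 5 - w 5| ≤ 4 * N := by rw [e5, abs_le]; constructor <;> linarith
  have q0 := abs_sq_sub_sq_sub_le hA hA' d0
  have q1 := abs_sq_sub_sq_sub_le hB hB' d1
  have q2 := abs_sq_sub_sq_sub_le hC hC' d2
  have q3 := abs_sq_sub_sq_sub_le hD hD' d3
  have q4 := abs_sq_sub_sq_sub_le hg hg' d4
  have q5 := abs_sq_sub_sq_sub_le hh hh' d5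
  obtain ⟨zx, zy⟩ := inner_edge_near hc hs hA hB hC hD
  obtain ⟨zx', zy'⟩ := inner_edge_near hc hs hA' hB' hC' hD'
  have c0 := abs_mul_sub_le hc d0
  have c1 := abs_mul_sub_le hc d1
  have c2 := abs_mul_sub_le hc d2
  have c3 := abs_mul_sub_le hc d3
  have s0 := abs_mul_sub_le hs d0
  have s1 := abs_mul_sub_le hs d1
  have s2 := abs_mul_sub_le hs d2
  have s3 := abs_mul_sub_le hs d3
  have s4 := abs_mul_sub_le hs d4
  have t0 := abs_mul_sub_le hq d0
  have t2 := abs_mul_sub_le hq d2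
  have t4 := abs_mul_sub_le hq d4
  have dx : |(7 * (c * u 2) + s * u 3 - 7 * u 0) - (7 * (c * w 2) + s * w 3 - 7 * w 0)|
      ≤ 40 * N := by
    simp only [abs_le] at c0 c1 c2 c3 s0 s1 s2 s3 d0 d1 d2 d3 ⊢
    clear q0 q1 q2 q3 q4 q5 t0 t2 t4 e0 e1 e2 e3 e4 e5
    constructor <;> linarith
  have dy : |(7 * (s * u 2) - c * u 3 - u 1) - (7 * (s * w 2) - c * w 3 - w 1)|
      ≤ 40 * N := by
    simp only [abs_le] at c0 c1 c2 c3 s0 s1 s2 s3 d0 d1 d2 d3 ⊢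
    clear q0 q1 q2 q3 q4 q5 t0 t2 t4 e0 e1 e2 e3 e4 e5
    constructor <;> linarith
  have dp : |(7 * u 2 - 7 * (c * u 0) - s * u 1) - (7 * w 2 - 7 * (c * w 0) - s * w 1)|
      ≤ 40 * N := by
    simp only [abs_le] at c0 c1 c2 c3 s0 s1 s2 s3 d0 d1 d2 d3 ⊢
    clear q0 q1 q2 q3 q4 q5 t0 t2 t4 e0 e1 e2 e3 e4 e5
    constructor <;> linarith
  have qx := abs_sq_sub_sq_sub_le zx zx' dx
  have qy := abs_sq_sub_sq_sub_le zy zy' dy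
  have tx := abs_mul_sub_le hq dx
  have tp := abs_mul_sub_le hq dp
  clear hA hA' hB hB' hC hC' hD hD' hg hg' hh hh' zx zx' zy zy' hc hs hq dx dy dp
    d0 d1 d2 d3 d4 d5
  rw [pi_norm_le_iff_of_nonneg (by positivity)]
  simp only [abs_le] at *
  intro i
  rw [Real.norm_eq_abs, abs_le]
  fin_cases i <;> simp only [closing, Pi.sub_apply, Fin.zero_eta, Fin.mk_one, Fin.reduceFinMk,
    Matrix.cons_val] <;> constructor <;> linarith

/-- The primitive sixth root of unity `e^{iπ/3}`. -/
def ω : ℂ := ⟨1 / 2, √3 / 2⟩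

theorem omega_re : ω.re = 1 / 2 := rfl

theorem omega_im : ω.im = √3 / 2 := rfl

theorem norm_eq_one_of_sq_add_sq {z : ℂ} (h : z.re ^ 2 + z.im ^ 2 = 1) : ‖z‖ = 1 := by
  have h2 : ‖z‖ ^ 2 = 1 := by rw [Complex.sq_norm, Complex.normSq_apply]; linarith
  exact (pow_eq_one_iff_of_nonneg (norm_nonneg z) two_ne_zero).1 h2

theorem norm_omega : ‖ω‖ = 1 := by
  have h : (√3) ^ 2 = 3 := Real.sq_sqrt (by norm_num)
  refine norm_eq_one_of_sq_add_sq ?_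
  rw [omega_re, omega_im]
  linarith

theorem norm_one_sub_omega : ‖1 - ω‖ = 1 := by
  have h : (√3) ^ 2 = 3 := Real.sq_sqrt (by norm_num)
  refine norm_eq_one_of_sq_add_sq ?_
  rw [Complex.sub_re, Complex.sub_im, omega_re, omega_im, Complex.one_re, Complex.one_im]
  linarith

/-- The data that determine a half sector: the common vertex `t` of the two triangle strips, the
edge vectors `W`, `W'` and `X`, `Y` of the strips, the edge vector `z` joining their inner ends,
and the edge vectors `H`, `K` of the cap. -/
structure Frame where
  t : ℂ
  W : ℂ
  W' : ℂ
  X : ℂ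
  Y : ℂ
  z : ℂ
  H : ℂ
  K : ℂ

/-- The vertices of the half sector with the given frame. -/
def Frame.vertex (f : Frame) : Fin 37 → ℂ :=
  ![
    f.t + ω * f.W,
    f.t + f.W + ω * f.W',
    f.t + f.W + f.W' + ω * f.W,
    f.t + 2 * f.W + f.W' + ω * f.W',
    f.t + 2 * f.W + 2 * f.W' + ω * f.W,
    f.t + 3 * f.W + 2 * f.W' + ω * f.W',
    f.t + 3 * f.W + 3 * f.W' + ω * f.W,
    f.t + 4 * f.W + 3 * f.W' + ω * f.z + f.H + f.K,
    f.t + f.X - ω * f.X,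
    f.t + f.X + f.Y - ω * f.Y,
    f.t + f.X + f.Y + f.X - ω * f.X,
    f.t + 2 * f.X + f.Y + f.Y - ω * f.Y,
    f.t + 2 * f.X + 2 * f.Y + f.X - ω * f.X,
    f.t + 3 * f.X + 2 * f.Y + f.Y - ω * f.Y,
    f.t + 3 * f.X + 3 * f.Y + f.X - ω * f.X,
    f.t + 4 * f.W + 3 * f.W' + ω * f.z + f.H - ω * f.H - ω * f.K,
    f.t + 4 * f.W + 3 * f.W' + ω * f.z + 2 * f.H - ω * f.H + f.K - ω * f.K,
    f.t,
    f.t + f.W,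
    f.t + f.W + f.W',
    f.t + 2 * f.W + f.W',
    f.t + 2 * f.W + 2 * f.W',
    f.t + 3 * f.W + 2 * f.W',
    f.t + 3 * f.W + 3 * f.W',
    f.t + 4 * f.W + 3 * f.W',
    f.t + f.X,
    f.t + f.X + f.Y,
    f.t + 2 * f.X + f.Y,
    f.t + 2 * f.X + 2 * f.Y,
    f.t + 3 * f.X + 2 * f.Y,
    f.t + 3 * f.X + 3 * f.Y,
    f.t + 4 * f.X + 3 * f.Y,
    f.t + 4 * f.W + 3 * f.W' + ω * f.z,
    f.t + 4 * f.W + 3 * f.W' + ω * f.z + f.H - ω * f.H,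
    f.t + 4 * f.W + 3 * f.W' + ω * f.z + f.H,
    f.t + 4 * f.W + 3 * f.W' + ω * f.z + f.H - ω * f.H - ω * f.K + f.K,
    f.t + 4 * f.W + 3 * f.W' + ω * f.z + f.H + f.K - ω * f.K]

theorem dist_of_unit_triangle {a b d e : ℂ} (he : ‖e‖ = 1) (hb : b = a + e)
    (hd : d = a + ω * e) : dist a b = 1 ∧ dist a d = 1 ∧ dist b d = 1 := by
  subst hb hd
  refine ⟨?_, ?_, ?_⟩
  · rw [dist_self_add_right, he]
  · rw [dist_self_add_right, norm_mul, norm_omega, he, one_mul]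
  · rw [dist_add_left, dist_eq_norm, ← one_sub_mul, norm_mul, norm_one_sub_omega, he, one_mul]

theorem Frame.dist_eq_one {f : Frame}
    (hz : f.t + 4 * f.X + 3 * f.Y = f.t + 4 * f.W + 3 * f.W' + f.z)
    (hW : ‖f.W‖ = 1) (hW' : ‖f.W'‖ = 1) (hX : ‖f.X‖ = 1) (hY : ‖f.Y‖ = 1)
    (h_z : ‖f.z‖ = 1) (hH : ‖f.H‖ = 1) (hK : ‖f.K‖ = 1) :
    ∀ e ∈ edges, dist (f.vertex e.1) (f.vertex e.2) = 1 := by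
  have tri := fun (a b d : Fin 37) => @dist_of_unit_triangle (f.vertex a) (f.vertex b) (f.vertex d)
  obtain ⟨x0, y0, z0⟩ := tri 17 18 0 hW
    (by simp only [Frame.vertex, Matrix.cons_val])
    (by simp only [Frame.vertex, Matrix.cons_val])
  obtain ⟨x1, y1, z1⟩ := tri 18 19 1 hW'
    (by simp only [Frame.vertex, Matrix.cons_val])
    (by simp only [Frame.vertex, Matrix.cons_val])
  obtain ⟨x2, y2, z2⟩ := tri 19 20 2 hW
    (by simp only [Frame.vertex, Matrix.cons_val]; ring)
    (by simp only [Frame.vertex, Matrix.cons_val])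
  obtain ⟨x3, y3, z3⟩ := tri 20 21 3 hW'
    (by simp only [Frame.vertex, Matrix.cons_val]; ring)
    (by simp only [Frame.vertex, Matrix.cons_val])
  obtain ⟨x4, y4, z4⟩ := tri 21 22 4 hW
    (by simp only [Frame.vertex, Matrix.cons_val]; ring)
    (by simp only [Frame.vertex, Matrix.cons_val])
  obtain ⟨x5, y5, z5⟩ := tri 22 23 5 hW'
    (by simp only [Frame.vertex, Matrix.cons_val]; ring)
    (by simp only [Frame.vertex, Matrix.cons_val])
  obtain ⟨x6, y6, z6⟩ := tri 23 24 6 hW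
    (by simp only [Frame.vertex, Matrix.cons_val]; ring)
    (by simp only [Frame.vertex, Matrix.cons_val])
  obtain ⟨x7, y7, z7⟩ := tri 25 17 8 ((norm_neg _).trans hX)
    (by simp only [Frame.vertex, Matrix.cons_val]; ring)
    (by simp only [Frame.vertex, Matrix.cons_val]; ring)
  obtain ⟨x8, y8, z8⟩ := tri 26 25 9 ((norm_neg _).trans hY)
    (by simp only [Frame.vertex, Matrix.cons_val]; ring)
    (by simp only [Frame.vertex, Matrix.cons_val]; ring)
  obtain ⟨x9, y9, z9⟩ := tri 27 26 10 ((norm_neg _).trans hX)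
    (by simp only [Frame.vertex, Matrix.cons_val]; ring)
    (by simp only [Frame.vertex, Matrix.cons_val]; ring)
  obtain ⟨x10, y10, z10⟩ := tri 28 27 11 ((norm_neg _).trans hY)
    (by simp only [Frame.vertex, Matrix.cons_val]; ring)
    (by simp only [Frame.vertex, Matrix.cons_val]; ring)
  obtain ⟨x11, y11, z11⟩ := tri 29 28 12 ((norm_neg _).trans hX)
    (by simp only [Frame.vertex, Matrix.cons_val]; ring)
    (by simp only [Frame.vertex, Matrix.cons_val]; ring)
  obtain ⟨x12, y12, z12⟩ := tri 30 29 13 ((norm_neg _).trans hY)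
    (by simp only [Frame.vertex, Matrix.cons_val]; ring)
    (by simp only [Frame.vertex, Matrix.cons_val]; ring)
  obtain ⟨x13, y13, z13⟩ := tri 31 30 14 ((norm_neg _).trans hX)
    (by simp only [Frame.vertex, Matrix.cons_val]; ring)
    (by simp only [Frame.vertex, Matrix.cons_val]; ring)
  obtain ⟨x14, y14, z14⟩ := tri 24 31 32 h_z
    (by simp only [Frame.vertex, Matrix.cons_val] <;> linear_combination hz)
    (by simp only [Frame.vertex, Matrix.cons_val])
  obtain ⟨x15, y15, z15⟩ := tri 34 32 33 ((norm_neg _).trans hH)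
    (by simp only [Frame.vertex, Matrix.cons_val]; ring)
    (by simp only [Frame.vertex, Matrix.cons_val]; ring)
  obtain ⟨x16, y16, z16⟩ := tri 15 35 33 hK
    (by simp only [Frame.vertex, Matrix.cons_val])
    (by simp only [Frame.vertex, Matrix.cons_val]; ring)
  obtain ⟨x17, y17, z17⟩ := tri 35 16 36 hH
    (by simp only [Frame.vertex, Matrix.cons_val]; ring)
    (by simp only [Frame.vertex, Matrix.cons_val]; ring)
  obtain ⟨x18, y18, z18⟩ := tri 7 34 36 ((norm_neg _).trans hK)
    (by simp only [Frame.vertex, Matrix.cons_val]; ring)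
    (by simp only [Frame.vertex, Matrix.cons_val]; ring)
  have sw : ∀ {a b : ℂ}, dist a b = 1 → dist b a = 1 :=
    fun {a b} h => (dist_comm b a).trans h
  simp only [edges, List.forall_mem_cons]
  exact ⟨sw y0, x0, sw z0, sw y1, x1, sw z1, sw y2, x2, sw z2, sw y3, x3, sw z3, sw y4, x4, sw
    z4, sw y5, x5, sw z5, sw y6, x6, sw z6, sw z7, sw x7, sw y7, sw z8, sw x8, sw y8, sw z9, sw
    x9, sw y9, sw z10, sw x10, sw y10, sw z11, sw x11, sw y11, sw z12, sw x12, sw y12, sw z13,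
    sw x13, sw y13, y14, x14, z14, z15, sw y15, sw x15, y16, sw z16, x16, sw x17, y17, z17, z18,
    y18, x18, by simp⟩

theorem ofNat_mul_re (n : ℕ) [n.AtLeastTwo] (z : ℂ) :
    (ofNat(n) * z : ℂ).re = ofNat(n) * z.re := by
  rw [← Complex.ofReal_ofNat, Complex.re_ofReal_mul]

theorem ofNat_mul_im (n : ℕ) [n.AtLeastTwo] (z : ℂ) :
    (ofNat(n) * z : ℂ).im = ofNat(n) * z.im := by
  rw [← Complex.ofReal_ofNat, Complex.im_ofReal_mul]

/-- The frame given by the solution `u` of the closing equations, where `c` and `s` are the cosine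
and sine of the mirror angle. -/
def frame (c s : ℝ) (u : Fin 6 → ℝ) : Frame where
  t := ⟨(c * -(√3 / 2 * u 0 + u 1 / 2) - u 3 / 2 - √3 / 2 * u 2) / s, -(√3 / 2 * u 0 + u 1 / 2)⟩
  W := ⟨u 0, u 1⟩
  W' := ⟨u 0, -u 1⟩
  X := ⟨c * u 2 + s * u 3, s * u 2 - c * u 3⟩
  Y := ⟨c * u 2 - s * u 3, s * u 2 + c * u 3⟩
  z := ⟨7 * (c * u 2) + s * u 3 - 7 * u 0, 7 * (s * u 2) - c * u 3 - u 1⟩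
  H := ⟨c * u 4 - s * u 5, c * u 5 + s * u 4⟩
  K := ⟨c * u 4 + s * u 5, s * u 4 - c * u 5⟩

theorem frame_dist_eq_one {c s : ℝ} {u : Fin 6 → ℝ} (hcs : c ^ 2 + s ^ 2 = 1)
    (hu : closing c s (√3 / 2) u = 0) :
    ∀ e ∈ edges, dist ((frame c s u).vertex e.1) ((frame c s u).vertex e.2) = 1 := by
  have h0 := congrFun hu 0
  have h1 := congrFun hu 1
  have h2 := congrFun hu 2
  have h3 := congrFun hu 3
  simp only [closing, Matrix.cons_val, Pi.zero_apply] at h0 h1 h2 h3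
  apply Frame.dist_eq_one
  · apply Complex.ext <;>
      simp only [frame, Complex.add_re, Complex.add_im, ofNat_mul_re,
        ofNat_mul_im] <;> ring
  all_goals
    apply norm_eq_one_of_sq_add_sq
    simp only [frame]
  · linear_combination h0
  · linear_combination h0
  · linear_combination (u 2 ^ 2 + u 3 ^ 2) * hcs + h1
  · linear_combination (u 2 ^ 2 + u 3 ^ 2) * hcs + h1
  · linear_combination h3
  · linear_combination (u 4 ^ 2 + u 5 ^ 2) * hcs + h2
  · linear_combination (u 4 ^ 2 + u 5 ^ 2) * hcs + h2

theorem frame_im_eq_zero {c s : ℝ} {u : Fin 6 → ℝ} (hu : closing c s (√3 / 2) u = 0)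
    (i : Fin 37) (hi : i < 8) : ((frame c s u).vertex i).im = 0 := by
  have h := congrFun hu 4
  simp only [closing, Matrix.cons_val, Pi.zero_apply] at h
  fin_cases i
  all_goals try exact absurd hi (by decide)
  on_goal 8 =>
    simp only [Fin.reduceFinMk, frame, Frame.vertex, Matrix.cons_val, Complex.add_im,
      ofNat_mul_im, Complex.mul_im, omega_re, omega_im]
    linear_combination h
  all_goals
    simp only [Fin.zero_eta, Fin.mk_one, Fin.reduceFinMk, frame, Frame.vertex, Matrix.cons_val,
      Complex.add_im, ofNat_mul_im, Complex.mul_im, omega_re, omega_im]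
    ring

theorem frame_mem_upper {c s : ℝ} {u : Fin 6 → ℝ} (hs : s ≠ 0) (hcs : c ^ 2 + s ^ 2 = 1)
    (hu : closing c s (√3 / 2) u = 0) (i : Fin 37) (hi : 8 ≤ i) (hi' : i < 17) :
    ((frame c s u).vertex i).im * c = ((frame c s u).vertex i).re * s := by
  have h := congrFun hu 5
  simp only [closing, Matrix.cons_val, Pi.zero_apply] at h
  set f := frame c s u with hf
  have ht : f.t.im * c - f.t.re * s = u 3 / 2 + √3 / 2 * u 2 := by
    simp only [hf, frame, div_mul_cancel₀ _ hs]
    ring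
  have hW : f.W.im * c - f.W.re * s = c * u 1 - s * u 0 := by
    simp only [hf, frame]; ring
  have hW' : f.W'.im * c - f.W'.re * s = -(c * u 1) - s * u 0 := by
    simp only [hf, frame]; ring
  have hX : f.X.im * c - f.X.re * s = -u 3 := by
    simp only [hf, frame]; linear_combination -u 3 * hcs
  have hY : f.Y.im * c - f.Y.re * s = u 3 := by
    simp only [hf, frame]; linear_combination u 3 * hcs
  have hH : f.H.im * c - f.H.re * s = u 5 := by
    simp only [hf, frame]; linear_combination u 5 * hcs
  have hK : f.K.im * c - f.K.re * s = -u 5 := by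
    simp only [hf, frame]; linear_combination -u 5 * hcs
  have hωX : (ω * f.X).im * c - (ω * f.X).re * s = √3 / 2 * u 2 - u 3 / 2 := by
    simp only [hf, frame, Complex.mul_im, Complex.mul_re, omega_re, omega_im]
    linear_combination (√3 / 2 * u 2 - u 3 / 2) * hcs
  have hωY : (ω * f.Y).im * c - (ω * f.Y).re * s = √3 / 2 * u 2 + u 3 / 2 := by
    simp only [hf, frame, Complex.mul_im, Complex.mul_re, omega_re, omega_im]
    linear_combination (√3 / 2 * u 2 + u 3 / 2) * hcs
  have hωH : (ω * f.H).im * c - (ω * f.H).re * s = √3 / 2 * u 4 + u 5 / 2 := by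
    simp only [hf, frame, Complex.mul_im, Complex.mul_re, omega_re, omega_im]
    linear_combination (√3 / 2 * u 4 + u 5 / 2) * hcs
  have hωK : (ω * f.K).im * c - (ω * f.K).re * s = √3 / 2 * u 4 - u 5 / 2 := by
    simp only [hf, frame, Complex.mul_im, Complex.mul_re, omega_re, omega_im]
    linear_combination (√3 / 2 * u 4 - u 5 / 2) * hcs
  have hωz : (ω * f.z).im * c - (ω * f.z).re * s =
      (7 * (s * u 0) - c * u 1 - u 3) / 2 + √3 / 2 * (7 * u 2 - 7 * (c * u 0) - s * u 1) := by
    simp only [hf, frame, Complex.mul_im, Complex.mul_re, omega_re, omega_im]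
    linear_combination (√3 / 2 * 7 * u 2 - u 3 / 2) * hcs
  clear_value f
  clear hf hu hcs hs
  fin_cases i
  all_goals first
    | exact absurd hi (by decide)
    | exact absurd hi' (by decide)
    | simp only [Fin.reduceFinMk, Frame.vertex, Matrix.cons_val, Complex.add_im, Complex.add_re,
        Complex.sub_im, Complex.sub_re, ofNat_mul_im, ofNat_mul_re]
      linarith

theorem omega_mul_near {e : ℂ} {x y : ℝ} (hx : |e.re - x| ≤ 0.0000000001)
    (hy : |e.im - y| ≤ 0.0000000001)
    (hx1 : |x| ≤ 1) (hy1 : |y| ≤ 1) :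
    |(ω * e).re - (x / 2 - 0.866025403784438647 * y)| ≤ 0.000000001 ∧
      |(ω * e).im - (y / 2 + 0.866025403784438647 * x)| ≤ 0.000000001 := by
  have h := sqrt_three_div_two_near
  have h1 := abs_mul_sub_mul_le h hx (by norm_num [abs_le]) hx1 (by norm_num)
  have h2 := abs_mul_sub_mul_le h hy (by norm_num [abs_le]) hy1 (by norm_num)
  rw [Complex.mul_re, Complex.mul_im, omega_re, omega_im]
  simp only [abs_le] at *
  refine ⟨⟨?_, ?_⟩, ⟨?_, ?_⟩⟩ <;> linarith

/-- The vector `e` agrees with `x + iy` up to a small error. -/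
def Near (e : ℂ) (x y : ℝ) : Prop := |e.re - x| ≤ 0.0000000001 ∧ |e.im - y| ≤ 0.0000000001

set_option maxHeartbeats 1600000 in
theorem frame_near {c s : ℝ} {v : Fin 6 → ℝ}
    (hc : |c - 0.999827223833360591| ≤ 0.000000000000001)
    (hs : |s - 0.018588235033887944| ≤ 0.000000000000001)
    (k0 : |v 0 - (-0.866041216768190411)| ≤ 0.000000000004)
    (k1 : |v 1 - (-0.499972610108466071)| ≤ 0.000000000004)
    (k2 : |v 2 - (-0.986356792911330554)| ≤ 0.000000000004)
    (k3 : |v 3 - (-0.164621617892895745)| ≤ 0.000000000004)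
    (k4 : |v 4 - (-0.999226197614280934)| ≤ 0.000000000004)
    (k5 : |v 5 - 0.039331997169047852| ≤ 0.000000000004) :
    (|(frame c s v).t.re - 104.17062559227367| ≤ 0.000000003 ∧
      |(frame c s v).t.im - 0.99999999949987| ≤ 0.000000003) ∧
    Near (frame c s v).W (-0.86604121676819) (-0.49997261010847) ∧
    Near (frame c s v).W' (-0.86604121676819) 0.49997261010847 ∧
    Near (frame c s v).X (-0.98924639929076) 0.14625854330690 ∧
    Near (frame c s v).Y (-0.98312634864066) (-0.18292780709472) ∧
    Near (frame c s v).z (-0.84407612570771) 0.53622336205192 ∧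
    Near (frame c s v).H (-0.99978466754998) 0.02075135012408 ∧
    Near (frame c s v).K (-0.99832244273452) (-0.05789905295062) := by
  have hz := inner_edge_near hc hs k0 k1 k2 k3
  have hq := sqrt_three_div_two_near
  have q0 := abs_mul_sub_mul_le hq k0 (by norm_num [abs_le]) (by norm_num [abs_le]) (by norm_num)
  have q2 := abs_mul_sub_mul_le hq k2 (by norm_num [abs_le]) (by norm_num [abs_le]) (by norm_num)
  have c2 := abs_mul_sub_mul_le hc k2 (by norm_num [abs_le]) (by norm_num [abs_le]) (by norm_num)
  have s2 := abs_mul_sub_mul_le hs k2 (by norm_num [abs_le]) (by norm_num [abs_le]) (by norm_num)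
  have c3 := abs_mul_sub_mul_le hc k3 (by norm_num [abs_le]) (by norm_num [abs_le]) (by norm_num)
  have s3 := abs_mul_sub_mul_le hs k3 (by norm_num [abs_le]) (by norm_num [abs_le]) (by norm_num)
  have c4 := abs_mul_sub_mul_le hc k4 (by norm_num [abs_le]) (by norm_num [abs_le]) (by norm_num)
  have s4 := abs_mul_sub_mul_le hs k4 (by norm_num [abs_le]) (by norm_num [abs_le]) (by norm_num)
  have c5 := abs_mul_sub_mul_le hc k5 (by norm_num [abs_le]) (by norm_num [abs_le]) (by norm_num)
  have s5 := abs_mul_sub_mul_le hs k5 (by norm_num [abs_le]) (by norm_num [abs_le]) (by norm_num)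
  have ht : |-(√3 / 2 * v 0 + v 1 / 2) - 0.999999999499871693| ≤ 0.000000000011 := by
    simp only [abs_le] at k1 q0 ⊢
    constructor <;> linarith
  have ct := abs_mul_sub_mul_le hc ht (by norm_num [abs_le]) (by norm_num [abs_le]) (by norm_num)
  have hs0 : 0 < s := by rw [abs_le] at hs; linarith
  refine ⟨⟨?_, ?_⟩, ?_⟩
  · have h : (frame c s v).t.re - 104.17062559227367 =
        (c * -(√3 / 2 * v 0 + v 1 / 2) - v 3 / 2 - √3 / 2 * v 2 - 104.17062559227367 * s) / s := by
      simp only [frame]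
      field_simp
    rw [h, abs_div, abs_of_pos hs0, div_le_iff₀ hs0]
    simp only [abs_le] at hs ct k3 q2 ⊢
    constructor <;> linarith
  · simp only [frame]
    simp only [abs_le] at ht ⊢
    constructor <;> linarith
  simp only [frame, Near]
  simp only [abs_le] at *
  refine ⟨⟨⟨?_, ?_⟩, ⟨?_, ?_⟩⟩, ⟨⟨?_, ?_⟩, ⟨?_, ?_⟩⟩, ⟨⟨?_, ?_⟩, ⟨?_, ?_⟩⟩, ⟨⟨?_, ?_⟩, ⟨?_, ?_⟩⟩,
    ⟨⟨?_, ?_⟩, ⟨?_, ?_⟩⟩, ⟨⟨?_, ?_⟩, ⟨?_, ?_⟩⟩, ⟨⟨?_, ?_⟩, ⟨?_, ?_⟩⟩⟩ <;> linarith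

/-- The vector `e` agrees with `x + iy` up to the error `d`. -/
def Within (d x y : ℝ) (e : ℂ) : Prop := |e.re - x| ≤ d ∧ |e.im - y| ≤ d

theorem Near.within {e : ℂ} {x y : ℝ} (h : Near e x y) : Within 0.0000000001 x y e := h

theorem Near.omega_mul {e : ℂ} {x y : ℝ} (h : Near e x y)
    (hx : |x| ≤ 1) (hy : |y| ≤ 1) :
    Within 0.000000001 (x / 2 - 0.866025403784438647 * y)
      (y / 2 + 0.866025403784438647 * x) (ω * e) :=
  omega_mul_near h.1 h.2 hx hy

theorem Within.add {d d' x x' y y' : ℝ} {e e' : ℂ} (h : Within d x y e) (h' : Within d' x' y' e') :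
    Within (d + d') (x + x') (y + y') (e + e') := by
  constructor
  · rw [Complex.add_re, add_sub_add_comm]
    exact (abs_add_le _ _).trans (add_le_add h.1 h'.1)
  · rw [Complex.add_im, add_sub_add_comm]
    exact (abs_add_le _ _).trans (add_le_add h.2 h'.2)

theorem Within.sub {d d' x x' y y' : ℝ} {e e' : ℂ} (h : Within d x y e) (h' : Within d' x' y' e') :
    Within (d + d') (x - x') (y - y') (e - e') := by
  constructor
  · rw [Complex.sub_re, sub_sub_sub_comm]
    exact (abs_sub _ _).trans (add_le_add h.1 h'.1)
  · rw [Complex.sub_im, sub_sub_sub_comm]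
    exact (abs_sub _ _).trans (add_le_add h.2 h'.2)

theorem Within.ofNat_mul {d x y : ℝ} {e : ℂ} (n : ℕ) [n.AtLeastTwo] (h : Within d x y e) :
    Within (ofNat(n) * d) (ofNat(n) * x) (ofNat(n) * y) (ofNat(n) * e) := by
  have hn : (0 : ℝ) ≤ ofNat(n) := Nat.ofNat_nonneg n
  constructor
  · rw [ofNat_mul_re, ← mul_sub, abs_mul, abs_of_nonneg hn]
    exact mul_le_mul_of_nonneg_left h.1 hn
  · rw [ofNat_mul_im, ← mul_sub, abs_mul, abs_of_nonneg hn]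
    exact mul_le_mul_of_nonneg_left h.2 hn

theorem Within.scale {d x y : ℝ} {e : ℂ} {m n : ℤ} (h : Within d x y e)
    (hm : x * 10 ^ 10 + d * 10 ^ 10 - m ≤ 100) (hm' : -100 ≤ x * 10 ^ 10 - d * 10 ^ 10 - m)
    (hn : y * 10 ^ 10 + d * 10 ^ 10 - n ≤ 100) (hn' : -100 ≤ y * 10 ^ 10 - d * 10 ^ 10 - n) :
    |e.re * 10 ^ 10 - m| ≤ 100 ∧ |e.im * 10 ^ 10 - n| ≤ 100 := by
  obtain ⟨h1, h2⟩ := h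
  rw [abs_le] at h1 h2
  refine ⟨abs_le.2 ⟨?_, ?_⟩, abs_le.2 ⟨?_, ?_⟩⟩ <;> linarith

set_option maxHeartbeats 4000000 in
theorem vertex_near {f : Frame}
    (ht : |f.t.re - 104.17062559227367| ≤ 0.000000003 ∧ |f.t.im - 0.99999999949987| ≤ 0.000000003)
    (hW : Near f.W (-0.86604121676819) (-0.49997261010847))
    (hW' : Near f.W' (-0.86604121676819) 0.49997261010847)
    (hX : Near f.X (-0.98924639929076) 0.14625854330690)
    (hY : Near f.Y (-0.98312634864066) (-0.18292780709472))
    (hz : Near f.z (-0.84407612570771) 0.53622336205192)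
    (hH : Near f.H (-0.99978466754998) 0.02075135012408)
    (hK : Near f.K (-0.99832244273452) (-0.05789905295062)) (i : Fin 37) :
    |(f.vertex i).re * 10 ^ 10 - X i| ≤ 100 ∧ |(f.vertex i).im * 10 ^ 10 - Y i| ≤ 100 := by
  replace ht : Within 0.000000003 104.17062559227367 0.99999999949987 f.t := ht
  have oW := hW.omega_mul (by norm_num [abs_le]) (by norm_num [abs_le])
  have oW' := hW'.omega_mul (by norm_num [abs_le]) (by norm_num [abs_le])
  have oX := hX.omega_mul (by norm_num [abs_le]) (by norm_num [abs_le])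
  have oY := hY.omega_mul (by norm_num [abs_le]) (by norm_num [abs_le])
  have oz := hz.omega_mul (by norm_num [abs_le]) (by norm_num [abs_le])
  have oH := hH.omega_mul (by norm_num [abs_le]) (by norm_num [abs_le])
  have oK := hK.omega_mul (by norm_num [abs_le]) (by norm_num [abs_le])
  replace hW := hW.within
  replace hW' := hW'.within
  replace hX := hX.within
  replace hY := hY.within
  replace hz := hz.within
  replace hH := hH.within
  replace hK := hK.within
  fin_cases i
  all_goals
    simp only [Fin.zero_eta, Fin.mk_one, Fin.reduceFinMk, Frame.vertex, Matrix.cons_val]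
    apply Within.scale
    · repeat first
        | assumption
        | apply Within.add
        | apply Within.sub
        | apply Within.ofNat_mul
    all_goals
      clear * -
      simp only [X, Y, xs, ys, Fin.isValue, Fin.coe_ofNat_eq_mod, Nat.reduceMod,
        List.getD_cons_succ, List.getD_cons_zero]
      norm_num

theorem exists_isRealization : ∃ P, IsRealization P := by
  obtain ⟨hc, hs⟩ := exp_mirrorAngle_near
  have hq := sqrt_three_div_two_near.trans
    (by norm_num : (0.0000000000000001 : ℝ) ≤ 0.000000000000001)
  obtain ⟨v, hv, hu⟩ := exists_zero_of_near_id
    (f := fun v => closing (Real.cos mirrorAngle) (Real.sin mirrorAngle) (√3 / 2) (chart v))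
    (by norm_num) (fun _ _ => closing_chart_near_id hc hs hq) (norm_closing_chart_zero_le hc hs hq)
  obtain ⟨k0, k1, k2, k3, k4, k5⟩ := chart_near hv
  obtain ⟨ht, hW, hW', hX, hY, hz, hH, hK⟩ := frame_near hc hs k0 k1 k2 k3 k4 k5
  have hs0 : Real.sin mirrorAngle ≠ 0 := by
    intro h
    rw [h] at hs
    norm_num [abs_le] at hs
  have hcs := Real.cos_sq_add_sin_sq mirrorAngle
  exact ⟨_, {
    re_near := fun i => (vertex_near ht hW hW' hX hY hz hH hK i).1
    im_near := fun i => (vertex_near ht hW hW' hX hY hz hH hK i).2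
    dist_eq_one := frame_dist_eq_one hcs hu
    im_eq_zero := frame_im_eq_zero hu
    mem_upper := frame_mem_upper hs0 hcs hu }⟩

end HalfSector

open Real in
/-- There exists a finite 4-regular planar straight-line
unit-distance graph consisting only of unit triangles without additional
triangles, with exactly `6422 = 169 * 38` unit triangles, invariant under the
rotation about some center by the angle `2π/169`. -/
theorem exists_planar_four_regular_ring_graph_order_169 :
    ∃ G : UnitDistGraph, ∃ c : ℂ, G.Planar ∧ G.Regular4 ∧ G.OnlyUnitTriangles ∧
      G.NoAdditionalTriangles ∧ G.triangleCount = 6422 ∧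
      G.RotInvariant c (2 * π / 169) := by
  obtain ⟨P, hP⟩ := HalfSector.exists_isRealization
  exact ⟨hP.ring, 0, hP.planar, hP.regular4, hP.onlyUnitTriangles, hP.noAdditionalTriangles,
    hP.triangleCount, hP.rotInvariant⟩
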